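/- arXiv:0810.1794 — 2 statements merged into one kernel-verified Lean document; each statement's English description precedes it below -/
import Mathlib

section
/- Let 1 ≤ n ≤ 5, let K ⊆ ℝⁿ be a convex body with nonempty interior, and let P be a real polynomial of degree at most n such that P(t) = vol(K + tB) for all real t ≥ 0. Then P is stable: every complex root z of P satisfies Re z < 0. (Stability of the Steiner polynomial in dimensions at most 5, via the Routh–Hurwitz criterion and the Aleksandrov–Fenchel inequalities.) -/
open MeasureTheory Metric Pointwise

/-- Two complex numbers, not both zero, whose quotient `q / p` lies in the closed right half-plane
of the Riemann sphere. -/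
def QuotRePos (p q : ℂ) : Prop := 0 ≤ (q * (starRingEnd ℂ) p).re ∧ (p ≠ 0 ∨ q ≠ 0)

lemma QuotRePos.step {p q z : ℂ} (h : QuotRePos p q) {b : ℝ} (hb : 0 ≤ b) (hz : 0 ≤ z.re) :
    QuotRePos q (b * z * q + p) := by
  obtain ⟨h1, h2⟩ := h
  refine ⟨?_, ?_⟩
  · simp only [Complex.mul_re, Complex.conj_re, Complex.conj_im, Complex.add_re, Complex.add_im,
      Complex.mul_im, Complex.ofReal_re, Complex.ofReal_im] at h1 ⊢
    have h3 : 0 ≤ b * z.re * (q.re ^ 2 + q.im ^ 2) := by positivity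
    nlinarith
  · by_cases hq : q = 0
    · right
      subst hq
      simpa using h2
    · exact Or.inl hq

lemma QuotRePos.add_ne_zero {p q : ℂ} (h : QuotRePos p q) : p + q ≠ 0 := by
  obtain ⟨h1, h2⟩ := h
  intro h3
  have hq : q = -p := by linear_combination h3
  subst hq
  have hp : p ≠ 0 := by simpa using h2
  have h4 : 0 < Complex.normSq p := Complex.normSq_pos.mpr hp
  rw [Complex.normSq_apply] at h4
  simp only [Complex.mul_re, Complex.conj_re, Complex.conj_im, Complex.neg_re,
    Complex.neg_im] at h1
  nlinarith

/-- Routh-Hurwitz criterion for quadratic polynomials. -/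
lemma re_neg_of_quadratic {a : ℕ → ℝ} (h0 : 0 < a 0) (h1 : 0 < a 1) (h2 : 0 ≤ a 2) {z : ℂ}
    (hz : (a 0 : ℂ) + a 1 * z + a 2 * z ^ 2 = 0) : z.re < 0 := by
  by_contra! hre
  have s0 : QuotRePos 0 (a 0 : ℂ) := ⟨by simp, Or.inr (by exact_mod_cast h0.ne')⟩
  have s1 := s0.step (b := a 1 / a 0) (by positivity) hre
  have s2 := s1.step (b := a 2 / a 1) (by positivity) hre
  refine s2.add_ne_zero (Eq.trans ?_ hz)
  have e0 : (a 0 : ℂ) ≠ 0 := by exact_mod_cast h0.ne'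
  have e1 : (a 1 : ℂ) ≠ 0 := by exact_mod_cast h1.ne'
  push_cast
  field_simp
  ring

/-- Routh-Hurwitz criterion for cubic polynomials. -/
lemma re_neg_of_cubic {a : ℕ → ℝ} (h0 : 0 < a 0) (h2 : 0 < a 2) (h3 : 0 < a 3)
    (h : a 0 * a 3 < a 1 * a 2) {z : ℂ}
    (hz : (a 0 : ℂ) + a 1 * z + a 2 * z ^ 2 + a 3 * z ^ 3 = 0) : z.re < 0 := by
  by_contra! hre
  have s0 : QuotRePos 0 (a 0 : ℂ) := ⟨by simp, Or.inr (by exact_mod_cast h0.ne')⟩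
  obtain ⟨δ, hδ⟩ : ∃ δ, δ = a 1 - a 0 * a 3 / a 2 := ⟨_, rfl⟩
  have hδ0 : 0 < δ := by rw [hδ, sub_pos, div_lt_iff₀ h2]; exact h
  have s1 := s0.step (b := δ / a 0) (by positivity) hre
  have s2 := s1.step (b := a 2 / δ) (by positivity) hre
  have s3 := s2.step (b := a 3 / a 2) (by positivity) hre
  refine s3.add_ne_zero (Eq.trans ?_ hz)
  have e0 : (a 0 : ℂ) ≠ 0 := by exact_mod_cast h0.ne'
  have e2 : (a 2 : ℂ) ≠ 0 := by exact_mod_cast h2.ne'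
  have e3 : (δ : ℂ) ≠ 0 := by exact_mod_cast hδ0.ne'
  have e4 : (a 1 : ℂ) = δ + a 0 * a 3 / a 2 := by rw [hδ]; push_cast; ring
  rw [e4]
  push_cast
  field_simp
  ring

/-- Routh-Hurwitz criterion for polynomials of degree four or five. -/
lemma re_neg_of_quintic {a : ℕ → ℝ} (h0 : 0 < a 0) (h4 : 0 < a 4) (h5 : 0 ≤ a 5)
    (hA : 0 < a 3 * a 4 - a 2 * a 5)
    (hB : 0 < a 1 * a 4 - a 0 * a 5)
    (h : (a 1 * a 4 - a 0 * a 5) ^ 2 < (a 3 * a 4 - a 2 * a 5) * (a 1 * a 2 - a 0 * a 3))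
    {z : ℂ} (hz : (a 0 : ℂ) + a 1 * z + a 2 * z ^ 2 + a 3 * z ^ 3 + a 4 * z ^ 4
      + a 5 * z ^ 5 = 0) : z.re < 0 := by
  by_contra! hre
  have s0 : QuotRePos 0 (a 0 : ℂ) := ⟨by simp, Or.inr (by exact_mod_cast h0.ne')⟩
  obtain ⟨α, hα⟩ : ∃ α, α = (a 3 * a 4 - a 2 * a 5) / a 4 := ⟨_, rfl⟩
  obtain ⟨β, hβ⟩ : ∃ β, β = (a 1 * a 4 - a 0 * a 5) / a 4 := ⟨_, rfl⟩
  have hα0 : 0 < α := by rw [hα]; positivity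
  have hβ0 : 0 < β := by rw [hβ]; positivity
  have eA : a 3 * a 4 - a 2 * a 5 = α * a 4 := by rw [hα]; field_simp
  have eB : a 1 * a 4 - a 0 * a 5 = β * a 4 := by rw [hβ]; field_simp
  have key : 0 < (a 2 * α - a 4 * β) * β - α ^ 2 * a 0 := by
    rw [eA, eB] at h
    have h1 : a 4 * (a 1 * a 2 - a 0 * a 3) = (a 2 * β - a 0 * α) * a 4 := by
      linear_combination a 2 * eB - a 0 * eA
    have h2 : a 1 * a 2 - a 0 * a 3 = a 2 * β - a 0 * α := by
      apply mul_left_cancel₀ h4.ne'; rw [h1]; ring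
    rw [h2] at h
    have : 0 < a 4 * ((a 2 * α - a 4 * β) * β - α ^ 2 * a 0) := by nlinarith
    exact (mul_pos_iff_of_pos_left h4).mp this
  obtain ⟨γ, hγ⟩ : ∃ γ, γ = (a 2 * α - a 4 * β) / α := ⟨_, rfl⟩
  have eγ : a 2 * α - a 4 * β = γ * α := by rw [hγ]; field_simp
  rw [eγ] at key
  have hγβ : 0 < γ * β - α * a 0 := by
    have : 0 < α * (γ * β - α * a 0) := by nlinarith
    exact (mul_pos_iff_of_pos_left hα0).mp this
  have hγ0 : 0 < γ := by
    have : 0 < γ * β := by nlinarith [mul_pos hα0 h0]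
    exact (mul_pos_iff_of_pos_right hβ0).mp this
  obtain ⟨δ, hδ⟩ : ∃ δ, δ = (γ * β - α * a 0) / γ := ⟨_, rfl⟩
  have hδ0 : 0 < δ := by rw [hδ]; positivity
  have eδ : γ * β - α * a 0 = δ * γ := by rw [hδ]; field_simp
  have s1 := s0.step (b := δ / a 0) (by positivity) hre
  have s2 := s1.step (b := γ / δ) (by positivity) hre
  have s3 := s2.step (b := α / γ) (by positivity) hre
  have s4 := s3.step (b := a 4 / α) (by positivity) hre
  have s5 := s4.step (b := a 5 / a 4) (by positivity) hre
  refine s5.add_ne_zero (Eq.trans ?_ hz)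
  have e0 : (a 0 : ℂ) ≠ 0 := by exact_mod_cast h0.ne'
  have e1 : (a 4 : ℂ) ≠ 0 := by exact_mod_cast h4.ne'
  have e2 : (α : ℂ) ≠ 0 := by exact_mod_cast hα0.ne'
  have e3 : (γ : ℂ) ≠ 0 := by exact_mod_cast hγ0.ne'
  have e4 : (δ : ℂ) ≠ 0 := by exact_mod_cast hδ0.ne'
  have c1 : β = δ + α * a 0 / γ := by field_simp; linarith
  have c2 : a 2 = γ + a 4 * β / α := by field_simp; linarith
  have c3 : a 3 = α + a 2 * a 5 / a 4 := by field_simp; linarith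
  have c4 : a 1 = β + a 0 * a 5 / a 4 := by field_simp; linarith
  rw [c4, c3, c2, c1]
  push_cast
  field_simp
  ring

/-- A positive ultra-log-concave polynomial of degree at most five is stable. -/
lemma re_neg_of_ultraLogConcave {n : ℕ} (hn1 : 1 ≤ n) (hn5 : n ≤ 5) {W : ℕ → ℝ}
    (hpos : ∀ k ≤ n, 0 < W k) (hzero : ∀ k, n < k → W k = 0)
    (hlc : ∀ k ≤ 3, W k * W (k + 2) ≤ W (k + 1) ^ 2) {z : ℂ}
    (hz : (W 0 : ℂ) + 5 * W 1 * z + 10 * W 2 * z ^ 2 + 10 * W 3 * z ^ 3 + 5 * W 4 * z ^ 4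
      + W 5 * z ^ 5 = 0) : z.re < 0 := by
  have l0 := hlc 0 (by norm_num)
  have l1 := hlc 1 (by norm_num)
  have l2 := hlc 2 (by norm_num)
  have l3 := hlc 3 (by norm_num)
  norm_num at l0 l1 l2 l3
  have p0 := hpos 0 (by omega)
  have p1 := hpos 1 (by omega)
  let a : ℕ → ℝ := fun k => Nat.choose 5 k * W k
  have a0 : a 0 = W 0 := by simp [a]
  have a1 : a 1 = 5 * W 1 := by simp [a]
  have a2 : a 2 = 10 * W 2 := by simp [a, Nat.choose]
  have a3 : a 3 = 10 * W 3 := by simp [a, Nat.choose]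
  have a4 : a 4 = 5 * W 4 := by simp [a, Nat.choose]
  have a5 : a 5 = W 5 := by simp [a]
  have step : ∀ {x y u v : ℝ}, 0 < y → 0 < u → 0 ≤ x → 0 ≤ v → x * u ≤ y ^ 2 → y * v ≤ u ^ 2 →
      x * v ≤ y * u := by
    intro x y u v hy hu hx hv h1 h2
    have h3 : (x * u) * (y * v) ≤ y ^ 2 * u ^ 2 :=
      mul_le_mul h1 h2 (by positivity) (by positivity)
    have h4 : 0 < y * u := by positivity
    by_contra! h5
    nlinarith
  rcases le_or_gt n 2 with h | h
  · have h2 : 0 ≤ W 2 := by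
      rcases Nat.lt_or_ge n 2 with h' | h'
      · exact (hzero 2 h').ge
      · exact (hpos 2 h').le
    refine re_neg_of_quadratic (a := a) (by rw [a0]; exact p0) (by rw [a1]; linarith)
      (by rw [a2]; linarith) ?_
    rw [hzero 3 (by omega), hzero 4 (by omega), hzero 5 (by omega)] at hz
    rw [a0, a1, a2, ← hz]
    push_cast
    ring
  have p2 := hpos 2 (by omega)
  have p3 := hpos 3 (by omega)
  have q03 := step p1 p2 p0.le p3.le l0 l1
  rcases le_or_gt n 3 with h' | h'
  · refine re_neg_of_cubic (a := a) (by rw [a0]; exact p0) (by rw [a2]; linarith)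
      (by rw [a3]; linarith) ?_ ?_
    · rw [a0, a1, a2, a3]
      nlinarith [mul_pos p1 p2]
    rw [hzero 4 (by omega), hzero 5 (by omega)] at hz
    rw [a0, a1, a2, a3, ← hz]
    push_cast
    ring
  have p4 := hpos 4 (by omega)
  have p5 : 0 ≤ W 5 := by
    rcases Nat.lt_or_ge n 5 with h' | h'
    · exact (hzero 5 h').ge
    · exact (hpos 5 h').le
  have q14 := step p2 p3 p1.le p4.le l1 l2
  have q25 := step p3 p4 p2.le p5 l2 l3
  have q05 : W 0 * W 5 ≤ W 1 * W 4 := by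
    have h1 : (W 0 * W 3) * (W 2 * W 5) ≤ (W 1 * W 2) * (W 3 * W 4) :=
      mul_le_mul q03 q25 (by positivity) (by positivity)
    have h2 : 0 < W 2 * W 3 := by positivity
    by_contra! h5
    nlinarith
  refine re_neg_of_quintic (a := a) (by rw [a0]; exact p0) (by rw [a4]; linarith)
    (by rw [a5]; exact p5) ?_ ?_ ?_ ?_
  · rw [a2, a3, a4, a5]; nlinarith [mul_pos p3 p4]
  · rw [a0, a1, a4, a5]; nlinarith [mul_pos p1 p4]
  · rw [a0, a1, a2, a3, a4, a5]
    have A : 40 * (W 3 * W 4) ≤ 10 * W 3 * (5 * W 4) - 10 * W 2 * W 5 := by linarith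
    have C : 40 * (W 1 * W 2) ≤ 5 * W 1 * (10 * W 2) - W 0 * (10 * W 3) := by linarith
    have B : 5 * W 1 * (5 * W 4) - W 0 * W 5 ≤ 25 * (W 1 * W 4) := by
      nlinarith [mul_nonneg p0.le p5]
    have B0 : 0 ≤ 5 * W 1 * (5 * W 4) - W 0 * W 5 := by nlinarith [mul_pos p1 p4]
    calc _ ≤ (25 * (W 1 * W 4)) ^ 2 := by gcongr
      _ = 625 * (W 1 * W 4) * (W 1 * W 4) := by ring
      _ ≤ 625 * (W 1 * W 4) * (W 2 * W 3) := by gcongr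
      _ < 1600 * (W 1 * W 4) * (W 2 * W 3) := by
        have : 0 < (W 1 * W 4) * (W 2 * W 3) := by positivity
        linarith
      _ = (40 * (W 3 * W 4)) * (40 * (W 1 * W 2)) := by ring
      _ ≤ _ := mul_le_mul A C (by positivity) (le_trans (by positivity) A)
  · rw [a0, a1, a2, a3, a4, a5, ← hz]
    push_cast
    ring

open Matrix in
lemma Matrix.IsHermitian.exists_dotProduct_eigenbasis {κ : Type*} [Fintype κ] [DecidableEq κ]
    {S : Matrix κ κ ℝ} (hS : S.IsHermitian) :
    ∃ (b : κ → κ → ℝ) (l : κ → ℝ), (∀ j, S *ᵥ b j = l j • b j) ∧ (∀ j, b j ⬝ᵥ b j = 1) ∧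
      ∀ x y : κ → ℝ, ∑ j, (b j ⬝ᵥ x) * (b j ⬝ᵥ y) = x ⬝ᵥ y := by
  refine ⟨fun j => ⇑(hS.eigenvectorBasis j), hS.eigenvalues, fun j => hS.mulVec_eigenvectorBasis j,
    fun j => ?_, fun x y => ?_⟩
  · have h := hS.eigenvectorBasis.orthonormal.1 j
    have h2 := real_inner_self_eq_norm_sq (hS.eigenvectorBasis j)
    rw [h] at h2
    rw [EuclideanSpace.inner_eq_star_dotProduct] at h2
    simpa using h2
  · have h := hS.eigenvectorBasis.sum_inner_mul_inner (WithLp.toLp 2 x) (WithLp.toLp 2 y)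
    simp only [EuclideanSpace.inner_eq_star_dotProduct, star_trivial] at h
    rw [dotProduct_comm x y, ← h]
    refine Finset.sum_congr rfl fun j _ => ?_
    rw [dotProduct_comm y]

open Matrix in
/-- A nonnegative symmetric matrix `H` which satisfies a Bochner-type inequality with respect to a
positive vector `w` is negative semidefinite on the orthogonal complement of `H w`. -/
lemma Matrix.dotProduct_mulVec_nonpos_of_bochner {κ : Type*} [Fintype κ] [DecidableEq κ]
    {H : Matrix κ κ ℝ} (hs : ∀ a b, H a b = H b a) (hnn : ∀ a b, 0 ≤ H a b) {w : κ → ℝ}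
    (hw : ∀ a, 0 < w a) {k : κ} (hk : ∀ a, (∀ b, H a b = 0) ∨ 0 < H k a)
    (hb : ∀ x : κ → ℝ, x ⬝ᵥ H *ᵥ x ≤ ∑ a, w a * (H *ᵥ x) a ^ 2 / (H *ᵥ w) a)
    {x : κ → ℝ} (hx : x ⬝ᵥ H *ᵥ w = 0) : x ⬝ᵥ H *ᵥ x ≤ 0 := by
  classical
  have hwpos : ∀ a, 0 < H k a → 0 < (H *ᵥ w) a := by
    intro a ha
    have h1 : H a k * w k ≤ (H *ᵥ w) a :=
      Finset.single_le_sum (f := fun b => H a b * w b)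
        (fun b _ => mul_nonneg (hnn a b) (hw b).le) (Finset.mem_univ k)
    have h2 : 0 < H a k * w k := by rw [hs a k]; exact mul_pos ha (hw k)
    linarith
  let D : Set κ := {a | 0 < H k a}
  have hrow : ∀ a ∉ D, ∀ b, H a b = 0 := fun a ha => (hk a).resolve_right ha
  have hrow' : ∀ a ∉ D, ∀ y, (H *ᵥ y) a = 0 := fun a ha y => by
    simp [mulVec, dotProduct, hrow a ha]
  let s : κ → ℝ := fun a => if a ∈ D then Real.sqrt ((H *ᵥ w) a / w a) else 1
  have hs0 : ∀ a, 0 < s a := by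
    intro a
    by_cases ha : a ∈ D
    · simp only [s, if_pos ha]
      exact Real.sqrt_pos.mpr (div_pos (hwpos a ha) (hw a))
    · simp only [s, if_neg ha]
      exact one_pos
  have hs2 : ∀ a ∈ D, s a ^ 2 * w a = (H *ᵥ w) a := by
    intro a ha
    have := hwpos a ha
    have h2 := hw a
    simp only [s, if_pos ha]
    rw [Real.sq_sqrt (by positivity)]
    field_simp
  let S : Matrix κ κ ℝ := fun a b => H a b / (s a * s b)
  have hSherm : S.IsHermitian := by
    ext a b
    change star (S b a) = S a b
    simp only [S, star_trivial, hs a b, mul_comm]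
  have hSmul : ∀ y a, s a * (S *ᵥ (fun b => s b * y b)) a = (H *ᵥ y) a := by
    intro y a
    simp only [mulVec, dotProduct, S, Finset.mul_sum]
    refine Finset.sum_congr rfl fun b _ => ?_
    have := hs0 a
    have := hs0 b
    field_simp
  have hSquad : ∀ y, (fun b => s b * y b) ⬝ᵥ (S *ᵥ (fun b => s b * y b)) = y ⬝ᵥ H *ᵥ y := by
    intro y
    simp only [dotProduct]
    refine Finset.sum_congr rfl fun b _ => ?_
    rw [← hSmul y b]
    ring
  obtain ⟨B, l, hB1, hB2, hB3⟩ := hSherm.exists_dotProduct_eigenbasis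
  let u : κ → ℝ := fun b => s b * x b
  have hdual : ∀ j, B j ⬝ᵥ (S *ᵥ u) = l j * (B j ⬝ᵥ u) := by
    intro j
    rw [dotProduct_mulVec, ← mulVec_transpose]
    have : Sᵀ = S := by
      have := hSherm.eq
      rwa [conjTranspose_eq_transpose_of_trivial] at this
    rw [this, hB1, smul_dotProduct, smul_eq_mul]
  have hgoal : x ⬝ᵥ H *ᵥ x = ∑ j, l j * (B j ⬝ᵥ u) ^ 2 := by
    rw [← hSquad x, ← hB3]
    refine Finset.sum_congr rfl fun j _ => ?_
    rw [hdual]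
    ring
  rw [hgoal]
  refine Finset.sum_nonpos fun j _ => ?_
  -- the `j`-th eigenvector in the original coordinates
  let y : κ → ℝ := fun b => B j b / s b
  have hyB : (fun b => s b * y b) = B j := by
    funext b
    have := hs0 b
    simp only [y]
    field_simp
  have hHy : ∀ a, (H *ᵥ y) a = l j * (s a * B j a) := by
    intro a
    rw [← hSmul y a, hyB, hB1]
    simp only [Pi.smul_apply, smul_eq_mul]
    ring
  have hyq : y ⬝ᵥ H *ᵥ y = l j := by
    rw [← hSquad y, hyB, hB1, dotProduct_smul, hB2, smul_eq_mul, mul_one]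
  have hsum1 : ∑ a, B j a ^ 2 = 1 := by
    rw [← hB2 j]
    simp only [dotProduct, sq]
  have hl2 : l j ≤ l j ^ 2 := by
    have h1 := hb y
    rw [hyq] at h1
    refine h1.trans ?_
    calc _ ≤ ∑ a, l j ^ 2 * B j a ^ 2 := by
          refine Finset.sum_le_sum fun a _ => ?_
          by_cases ha : a ∈ D
          · have h2 := hwpos a ha
            have h3 := hw a
            rw [hHy, ← hs2 a ha]
            have := hs0 a
            apply le_of_eq
            field_simp
          · rw [hrow' a ha]
            simp only [ne_eq, OfNat.ofNat_ne_zero, not_false_eq_true, zero_pow, mul_zero, zero_div]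
            positivity
      _ = l j ^ 2 := by rw [← Finset.mul_sum, hsum1, mul_one]
  have hschur : ∑ a, (H *ᵥ w) a / w a * y a ^ 2 - y ⬝ᵥ H *ᵥ y
      = ∑ a, ∑ b, H a b * w a * w b * (y a / w a - y b / w b) ^ 2 / 2 := by
    have e1 : ∑ a, (H *ᵥ w) a / w a * y a ^ 2 = ∑ a, ∑ b, H a b * w b / w a * y a ^ 2 := by
      refine Finset.sum_congr rfl fun a _ => ?_
      simp only [mulVec, dotProduct, Finset.sum_div, Finset.sum_mul]
    have e2 : ∑ a, (H *ᵥ w) a / w a * y a ^ 2 = ∑ a, ∑ b, H a b * w a / w b * y b ^ 2 := by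
      rw [e1, Finset.sum_comm]
      refine Finset.sum_congr rfl fun a _ => Finset.sum_congr rfl fun b _ => ?_
      rw [hs b a]
    have e3 : y ⬝ᵥ H *ᵥ y = ∑ a, ∑ b, H a b * y a * y b := by
      simp only [mulVec, dotProduct, Finset.mul_sum]
      refine Finset.sum_congr rfl fun a _ => Finset.sum_congr rfl fun b _ => ?_
      ring
    have e4 : ∑ a, (H *ᵥ w) a / w a * y a ^ 2 =
        ((∑ a, ∑ b, H a b * w b / w a * y a ^ 2) + ∑ a, ∑ b, H a b * w a / w b * y b ^ 2) / 2 := by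
      rw [← e1, ← e2]; ring
    rw [e4, e3, ← Finset.sum_add_distrib, Finset.sum_div, ← Finset.sum_sub_distrib]
    refine Finset.sum_congr rfl fun a _ => ?_
    rw [← Finset.sum_add_distrib, Finset.sum_div, ← Finset.sum_sub_distrib]
    refine Finset.sum_congr rfl fun b _ => ?_
    have := hw a
    have := hw b
    field_simp
    ring
  have hterm : ∀ a b, 0 ≤ H a b * w a * w b * (y a / w a - y b / w b) ^ 2 / 2 := by
    intro a b
    have := hnn a b
    have := hw a
    have := hw b
    positivity
  have hdy : ∑ a, (H *ᵥ w) a / w a * y a ^ 2 ≤ 1 := by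
    rw [← hsum1]
    refine Finset.sum_le_sum fun a _ => ?_
    by_cases ha : a ∈ D
    · rw [← hs2 a ha]
      have := hs0 a
      have := hw a
      simp only [y]
      apply le_of_eq
      field_simp
    · rw [hrow' a ha]
      simp only [zero_div, zero_mul]
      positivity
  have hl1 : l j ≤ 1 := by
    have : 0 ≤ ∑ a, ∑ b, H a b * w a * w b * (y a / w a - y b / w b) ^ 2 / 2 :=
      Finset.sum_nonneg fun a _ => Finset.sum_nonneg fun b _ => hterm a b
    rw [← hschur, hyq] at this
    linarith
  rcases le_or_gt (l j) 0 with h0 | h0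
  · exact mul_nonpos_of_nonpos_of_nonneg h0 (sq_nonneg _)
  · have hl : l j = 1 := by nlinarith
    suffices h : B j ⬝ᵥ u = 0 by rw [h]; simp
    have hz : ∑ a, ∑ b, H a b * w a * w b * (y a / w a - y b / w b) ^ 2 / 2 = 0 := by
      refine le_antisymm ?_ (Finset.sum_nonneg fun a _ => Finset.sum_nonneg fun b _ => hterm a b)
      rw [← hschur, hyq, hl]
      linarith
    rw [Finset.sum_eq_zero_iff_of_nonneg
      fun a _ => Finset.sum_nonneg fun b _ => hterm a b] at hz
    have hz1 := hz k (Finset.mem_univ k)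
    rw [Finset.sum_eq_zero_iff_of_nonneg fun b _ => hterm k b] at hz1
    have hc : ∀ a ∈ D, B j a = (y k / w k) * (s a * w a) := by
      intro a ha
      have h1 := hz1 a (Finset.mem_univ a)
      have h2 : 0 < H k a * w k * w a := mul_pos (mul_pos ha (hw k)) (hw a)
      have h3 : (y k / w k - y a / w a) ^ 2 = 0 := by
        have h4 : H k a * w k * w a * (y k / w k - y a / w a) ^ 2 = 0 := by linarith
        exact (mul_eq_zero.mp h4).resolve_left h2.ne'
      have h4 : y k / w k = y a / w a := by
        have := pow_eq_zero_iff (two_ne_zero) |>.mp h3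
        linarith
      rw [h4]
      have := hw a
      have := hs0 a
      simp only [y]
      field_simp
    have hc0 : ∀ a ∉ D, B j a = 0 := by
      intro a ha
      have h1 := hHy a
      rw [hrow' a ha, hl, one_mul] at h1
      exact (mul_eq_zero.mp h1.symm).resolve_left (hs0 a).ne'
    have : B j ⬝ᵥ u = (y k / w k) * (x ⬝ᵥ H *ᵥ w) := by
      simp only [dotProduct, Finset.mul_sum]
      refine Finset.sum_congr rfl fun a _ => ?_
      by_cases ha : a ∈ D
      · rw [hc a ha, ← hs2 a ha]
        simp only [u]
        ring
      · rw [hc0 a ha, hrow' a ha]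
        ring
    rw [this, hx, mul_zero]

/-- A bilinear form satisfies the reverse Cauchy-Schwarz inequality at all nonnegative vectors. -/
def IsLorentz {E : Type*} [AddCommGroup E] [Module ℝ E] (B : E →ₗ[ℝ] E →ₗ[ℝ] ℝ) : Prop :=
  ∀ x y, 0 ≤ B y y → B x x * B y y ≤ B x y ^ 2

lemma IsLorentz.of_pos {E : Type*} [AddCommGroup E] [Module ℝ E] {B : E →ₗ[ℝ] E →ₗ[ℝ] ℝ}
    (hs : ∀ x y, B x y = B y x) {v : E} (hv : 0 < B v v)
    (h : ∀ x, B x x * B v v ≤ B x v ^ 2) : IsLorentz B := by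
  intro x y hy
  rcases le_or_gt (B x x) 0 with hx | hx
  · nlinarith [sq_nonneg (B x y)]
  rcases hy.eq_or_lt with hy | hy
  · rw [← hy, mul_zero]; positivity
  have hz := h (B y v • x - B x v • y)
  simp only [map_sub, map_smul, LinearMap.sub_apply, LinearMap.smul_apply, smul_eq_mul,
    hs y x] at hz
  have hz2 : B y v ^ 2 * B x x - 2 * (B x v * B y v) * B x y + B x v ^ 2 * B y y ≤ 0 := by
    have : (B y v ^ 2 * B x x - 2 * (B x v * B y v) * B x y + B x v ^ 2 * B y y) * B v v ≤ 0 := by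
      nlinarith
    exact nonpos_of_mul_nonpos_left this hv
  have hxv : 0 < B x v ^ 2 := lt_of_lt_of_le (mul_pos hx hv) (h x)
  have hyv : 0 < B y v ^ 2 := lt_of_lt_of_le (mul_pos hy hv) (h y)
  have h1 : (B y v ^ 2 * B x x + B x v ^ 2 * B y y) ^ 2 ≤ (2 * (B x v * B y v) * B x y) ^ 2 := by
    apply pow_le_pow_left₀ (by positivity)
    linarith
  have h2 : 0 < B x v ^ 2 * B y v ^ 2 := mul_pos hxv hyv
  have h3 : (B x v ^ 2 * B y v ^ 2) * (B x x * B y y) ≤ (B x v ^ 2 * B y v ^ 2) * B x y ^ 2 := by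
    nlinarith [sq_nonneg (B y v ^ 2 * B x x - B x v ^ 2 * B y y)]
  exact le_of_mul_le_mul_left h3 h2

lemma LinearMap.apply_eq_sum_single {κ M : Type*} [Fintype κ] [DecidableEq κ] [AddCommMonoid M]
    [Module ℝ M] (f : (κ → ℝ) →ₗ[ℝ] M) (x : κ → ℝ) :
    f x = ∑ a, x a • f (Pi.single a 1) := by
  conv_lhs => rw [← Finset.univ_sum_single x]
  rw [map_sum]
  refine Finset.sum_congr rfl fun a _ => ?_
  rw [← map_smul]
  congr 1
  ext b
  by_cases h : b = a
  · subst h; simp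
  · simp [h]

/-- Bochner's method: a positive combination of Lorentzian slices of a symmetric nonnegative
trilinear form is Lorentzian. -/
lemma IsLorentz.bochner {κ : Type*} [Fintype κ] [DecidableEq κ]
    {U : (κ → ℝ) →ₗ[ℝ] (κ → ℝ) →ₗ[ℝ] (κ → ℝ) →ₗ[ℝ] ℝ}
    (hs1 : ∀ x y z, U x y z = U y x z) (hs2 : ∀ x y z, U x y z = U x z y)
    (hnn : ∀ a b c, 0 ≤ U (Pi.single a 1) (Pi.single b 1) (Pi.single c 1))
    {w : κ → ℝ} (hw : ∀ a, 0 < w a) (hL : ∀ a, IsLorentz (U (Pi.single a 1))) {k : κ}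
    (hk : ∀ a, U (Pi.single a 1) = 0 ∨ 0 < U w (Pi.single k 1) (Pi.single a 1)) :
    IsLorentz (U w) := by
  have hnw : ∀ a b, 0 ≤ U w (Pi.single a 1) (Pi.single b 1) := by
    intro a b
    rw [U.apply_eq_sum_single w]
    simp only [LinearMap.sum_apply, LinearMap.smul_apply, smul_eq_mul]
    exact Finset.sum_nonneg fun c _ => mul_nonneg (hw c).le (hnn c a b)
  let H : Matrix κ κ ℝ := fun a b => U w (Pi.single a 1) (Pi.single b 1)
  have hH : ∀ x a, (H.mulVec x) a = U w (Pi.single a 1) x := by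
    intro x a
    rw [(U w (Pi.single a 1)).apply_eq_sum_single x]
    simp only [Matrix.mulVec, dotProduct, H, smul_eq_mul, mul_comm]
  have hHq : ∀ x y, x ⬝ᵥ H.mulVec y = U w x y := by
    intro x y
    rw [(U w).apply_eq_sum_single x]
    simp only [dotProduct, hH, LinearMap.sum_apply, LinearMap.smul_apply, smul_eq_mul]
  have hpos : ∀ a, U (Pi.single a 1) = 0 ∨ 0 < U w (Pi.single a 1) w := by
    intro a
    refine (hk a).imp id fun h => ?_
    rw [(U w (Pi.single a 1)).apply_eq_sum_single w]
    refine lt_of_lt_of_le (mul_pos (hw k) h) ?_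
    rw [hs2]
    exact Finset.single_le_sum (f := fun c => w c • U w (Pi.single a 1) (Pi.single c 1))
      (fun c _ => mul_nonneg (hw c).le (hnw a c)) (Finset.mem_univ k)
  have key : ∀ x, U w x w = 0 → U w x x ≤ 0 := by
    intro x hx
    rw [← hHq]
    refine Matrix.dotProduct_mulVec_nonpos_of_bochner (H := H) (w := w) (k := k)
      (fun a b => hs2 _ _ _) hnw hw (fun a => (hk a).imp (fun h b => ?_) id) ?_ ?_
    · simp only [H, hs1 w (Pi.single a 1), h, LinearMap.zero_apply]
    · intro x
      rw [hHq]
      refine (congrArg (fun B => B x x) (U.apply_eq_sum_single w)).trans_le ?_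
      simp only [LinearMap.sum_apply, LinearMap.smul_apply, smul_eq_mul]
      refine Finset.sum_le_sum fun a _ => ?_
      rw [hH, hH, mul_div_assoc]
      refine mul_le_mul_of_nonneg_left ?_ (hw a).le
      rcases hpos a with h | h
      · simp only [hs1 w, h, LinearMap.zero_apply]
        simp
      · have h1 := hL a x w (by rw [hs1]; exact h.le)
        rw [le_div_iff₀ h, hs1 w, hs1 w, hs2 _ w x]
        exact h1
    · rw [hHq, hx]
  by_cases h0 : ∀ a, U (Pi.single a 1) = 0
  · have : U w = 0 := by
      rw [U.apply_eq_sum_single w]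
      simp [h0]
    intro x y _
    simp [this]
  · push Not at h0
    obtain ⟨a, ha⟩ := h0
    have hww : 0 < U w w w := by
      rw [(U w).apply_eq_sum_single w]
      simp only [LinearMap.sum_apply, LinearMap.smul_apply, smul_eq_mul]
      refine lt_of_lt_of_le (mul_pos (hw a) ((hpos a).resolve_left ha)) ?_
      refine Finset.single_le_sum (f := fun c => w c * U w (Pi.single c 1) w)
        (fun c _ => mul_nonneg (hw c).le ?_) (Finset.mem_univ a)
      rcases hpos c with h | h
      · rw [hs1, h]; simp
      · exact h.le
    refine IsLorentz.of_pos (hs2 w) hww fun x => ?_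
    have h1 := key (x - (U w x w / U w w w) • w) (by
      simp only [map_sub, map_smul, LinearMap.sub_apply, LinearMap.smul_apply, smul_eq_mul]
      field_simp
      ring)
    simp only [map_sub, map_smul, LinearMap.sub_apply, LinearMap.smul_apply, smul_eq_mul,
      hs2 w w x] at h1
    have h2 : U w x x - U w x w ^ 2 / U w w w ≤ 0 := by
      refine le_of_eq_of_le ?_ h1
      field_simp
      ring
    rw [sub_nonpos, le_div_iff₀ hww] at h2
    exact h2

/-- Quintilinear forms on `κ → ℝ`. -/
abbrev QuintForm (κ : Type*) : Type _ :=
  (κ → ℝ) →ₗ[ℝ] (κ → ℝ) →ₗ[ℝ] (κ → ℝ) →ₗ[ℝ] (κ → ℝ) →ₗ[ℝ] (κ → ℝ) →ₗ[ℝ] ℝ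

/-- The properties of the mixed volumes of a convex body (index `none`) and finitely many pairwise
non-parallel segments (indices `some i`) that yield the Aleksandrov-Fenchel inequalities. -/
structure QuintForm.IsMixed {ι : Type*} [DecidableEq ι] (V : QuintForm (Option ι)) : Prop where
  swap12 : ∀ x y z t u, V x y z t u = V y x z t u
  swap23 : ∀ x y z t u, V x y z t u = V x z y t u
  swap34 : ∀ x y z t u, V x y z t u = V x y t z u
  swap45 : ∀ x y z t u, V x y z t u = V x y z u t
  nonneg_single : ∀ a b c d e, 0 ≤ V (Pi.single a 1) (Pi.single b 1) (Pi.single c 1)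
    (Pi.single d 1) (Pi.single e 1)
  segment_segment : ∀ i, V (Pi.single (some i) 1) (Pi.single (some i) 1) = 0
  pos_body : 0 < V (Pi.single none 1) (Pi.single none 1) (Pi.single none 1) (Pi.single none 1)
    (Pi.single none 1)
  pos_segment : ∀ i, 0 < V (Pi.single none 1) (Pi.single none 1) (Pi.single none 1)
    (Pi.single none 1) (Pi.single (some i) 1)
  pos_segment_segment : ∀ i j, i ≠ j → 0 < V (Pi.single none 1) (Pi.single none 1)
    (Pi.single none 1) (Pi.single (some i) 1) (Pi.single (some j) 1)
  log_concave : ∀ w w' : Option ι → ℝ, (∀ a, 0 < w a) → (∀ a, 0 < w' a) →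
    V w w w w w * V w' w' w' w' w' ≤
    (V ((1 / 2 : ℝ) • (w + w')) ((1 / 2 : ℝ) • (w + w')) ((1 / 2 : ℝ) • (w + w'))
      ((1 / 2 : ℝ) • (w + w')) ((1 / 2 : ℝ) • (w + w'))) ^ 2

lemma LinearMap.apply_nonneg_of_single {κ : Type*} [Fintype κ] [DecidableEq κ]
    {L : (κ → ℝ) →ₗ[ℝ] ℝ} (hL : ∀ a, 0 ≤ L (Pi.single a 1)) {w : κ → ℝ} (hw : 0 ≤ w) :
    0 ≤ L w := by
  rw [L.apply_eq_sum_single w]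
  exact Finset.sum_nonneg fun c _ => mul_nonneg (hw c) (hL c)

lemma nonpos_at_zero_of_small {f : ℝ → ℝ} (hf : Continuous f) {d : ℝ} (hd : 0 < d)
    (h : ∀ t, 0 < t → t < d → f t ≤ 0) : f 0 ≤ 0 := by
  refine le_of_tendsto (f := f) (x := nhdsWithin 0 (Set.Ioi 0)) hf.continuousWithinAt ?_
  filter_upwards [Ioo_mem_nhdsGT hd] with t ht using h t ht.1 ht.2

lemma leading_coeff_nonpos {a b c d e : ℝ}
    (h : ∀ R : ℝ, 0 < R → a + b * R + c * R ^ 2 + d * R ^ 3 + e * R ^ 4 ≤ 0) : e ≤ 0 := by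
  have := nonpos_at_zero_of_small
    (f := fun t => a * t ^ 4 + b * t ^ 3 + c * t ^ 2 + d * t + e) (by fun_prop) one_pos
    (fun t ht _ => by
      have h1 := h t⁻¹ (inv_pos.2 ht)
      have h2 : a * t ^ 4 + b * t ^ 3 + c * t ^ 2 + d * t + e =
          t ^ 4 * (a + b * t⁻¹ + c * t⁻¹ ^ 2 + d * t⁻¹ ^ 3 + e * t⁻¹ ^ 4) := by
        field_simp
      rw [h2]
      exact mul_nonpos_of_nonneg_of_nonpos (by positivity) h1)
  simpa using this

namespace QuintForm.IsMixed

variable {ι : Type*} [DecidableEq ι] {V : QuintForm (Option ι)}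

lemma single_nonneg (a : Option ι) : (0 : Option ι → ℝ) ≤ Pi.single a 1 :=
  Pi.single_nonneg.2 zero_le_one

lemma apply_self_add_smul (hV : V.IsMixed) (w z : Option ι → ℝ) (s : ℝ) :
    V (w + s • z) (w + s • z) (w + s • z) (w + s • z) (w + s • z) =
      V w w w w w + 5 * s * V w w w w z + 10 * s ^ 2 * V w w w z z + 10 * s ^ 3 * V w w z z z +
        5 * s ^ 4 * V w z z z z + s ^ 5 * V z z z z z := by
  simp only [map_add, map_smul, LinearMap.add_apply, LinearMap.smul_apply, smul_eq_mul,
    hV.swap12 z w, hV.swap23 _ z w, hV.swap34 _ _ z w, hV.swap45 _ _ _ z w]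
  ring

variable [Fintype ι]

lemma nonneg (hV : V.IsMixed) {x y z t u : Option ι → ℝ} (hx : 0 ≤ x) (hy : 0 ≤ y) (hz : 0 ≤ z)
    (ht : 0 ≤ t) (hu : 0 ≤ u) : 0 ≤ V x y z t u := by
  rw [V.apply_eq_sum_single x]
  simp only [LinearMap.sum_apply, LinearMap.smul_apply, smul_eq_mul]
  refine Finset.sum_nonneg fun a _ => mul_nonneg (hx a) ?_
  rw [(V _).apply_eq_sum_single y]
  simp only [LinearMap.sum_apply, LinearMap.smul_apply, smul_eq_mul]
  refine Finset.sum_nonneg fun b _ => mul_nonneg (hy b) ?_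
  rw [(V _ _).apply_eq_sum_single z]
  simp only [LinearMap.sum_apply, LinearMap.smul_apply, smul_eq_mul]
  refine Finset.sum_nonneg fun c _ => mul_nonneg (hz c) ?_
  rw [(V _ _ _).apply_eq_sum_single t]
  simp only [LinearMap.sum_apply, LinearMap.smul_apply, smul_eq_mul]
  refine Finset.sum_nonneg fun d _ => mul_nonneg (ht d) ?_
  exact LinearMap.apply_nonneg_of_single (hV.nonneg_single a b c d) hu

/-- The lower bound on a form in terms of the body coefficient in its fourth argument. -/
lemma pos_of_pos_body (hV : V.IsMixed) {w x y z u : Option ι → ℝ} (hw : 0 ≤ w)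
    (hw0 : 0 < w none) (hx : 0 ≤ x) (hy : 0 ≤ y) (hz : 0 ≤ z) (hu : 0 ≤ u)
    (h : 0 < V (Pi.single none 1) x y z u) : 0 < V w x y z u := by
  rw [V.apply_eq_sum_single w]
  simp only [LinearMap.sum_apply, LinearMap.smul_apply, smul_eq_mul]
  exact lt_of_lt_of_le (mul_pos hw0 h) (Finset.single_le_sum
    (f := fun c => w c * V (Pi.single c 1) x y z u)
      (fun c _ => mul_nonneg (hw c) (hV.nonneg (single_nonneg c) hx hy hz hu))
      (Finset.mem_univ none))

lemma isLorentz_self (hV : V.IsMixed) {w : Option ι → ℝ} (hw : ∀ a, 0 < w a) :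
    IsLorentz (V w w w) := by
  have hw0 : 0 ≤ w := fun a => (hw a).le
  have hF : 0 < V w w w w w := by
    refine hV.pos_of_pos_body hw0 (hw _) hw0 hw0 hw0 hw0 ?_
    rw [hV.swap12]
    refine hV.pos_of_pos_body hw0 (hw _) (single_nonneg _) hw0 hw0 hw0 ?_
    rw [hV.swap23, hV.swap12]
    refine hV.pos_of_pos_body hw0 (hw _) (single_nonneg _) (single_nonneg _) hw0 hw0 ?_
    rw [hV.swap34, hV.swap23, hV.swap12]
    refine hV.pos_of_pos_body hw0 (hw _) (single_nonneg _) (single_nonneg _) (single_nonneg _)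
      hw0 ?_
    rw [hV.swap45, hV.swap34, hV.swap23, hV.swap12]
    exact hV.pos_of_pos_body hw0 (hw _) (single_nonneg _) (single_nonneg _) (single_nonneg _)
      (single_nonneg _) hV.pos_body
  have main : ∀ z, 4 * V w w w w w * V w w w z z ≤ 5 * V w w w w z ^ 2 := by
    intro z
    obtain ⟨d, hd, hdz⟩ : ∃ d > 0, ∀ t : ℝ, 0 < t → t < d → ∀ a, t * |z a| < w a := by
      have h1 : ∀ a, ∀ᶠ t in nhdsWithin (0 : ℝ) (Set.Ioi 0), t * |z a| < w a := by
        intro a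
        have : Filter.Tendsto (fun t : ℝ => t * |z a|) (nhdsWithin (0 : ℝ) (Set.Ioi 0))
            (nhds (0 * |z a|)) := by
          refine Filter.Tendsto.mono_left (Continuous.tendsto (by fun_prop) 0) nhdsWithin_le_nhds
        rw [zero_mul] at this
        filter_upwards [this.eventually (gt_mem_nhds (hw a))] with t ht using ht
      have h2 := Filter.eventually_all.2 h1
      obtain ⟨d, hd, h3⟩ := mem_nhdsGT_iff_exists_Ioo_subset.1 h2
      exact ⟨d, hd, fun t h4 h5 => h3 ⟨h4, h5⟩⟩
    generalize h0 : V w w w w w = c0 at *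
    generalize h1 : V w w w w z = c1
    generalize h2 : V w w w z z = c2
    generalize h3 : V w w z z z = c3
    generalize h4 : V w z z z z = c4
    generalize h5 : V z z z z z = c5
    have := nonpos_at_zero_of_small (f := fun t => (20 * c0 * c2 - 25 * c1 ^ 2) +
      t ^ 2 * (10 * c0 * c4 + 100 * c2 ^ 2 - 100 * c1 * c3) +
      t ^ 4 * (100 * c2 * c4 - 100 * c3 ^ 2 - 10 * c1 * c5) +
      t ^ 6 * (25 * c4 ^ 2 - 20 * c3 * c5) - t ^ 8 * c5 ^ 2) (by fun_prop) hd
      (fun t ht htd => by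
        have h := hV.log_concave (w + t • z) (w + (-t) • z)
          (fun a => by
            have := hdz t ht htd a
            have := neg_abs_le (t * z a)
            rw [abs_mul, abs_of_pos ht] at this
            simp only [Pi.add_apply, Pi.smul_apply, smul_eq_mul]
            linarith)
          (fun a => by
            have := hdz t ht htd a
            have := le_abs_self (t * z a)
            rw [abs_mul, abs_of_pos ht] at this
            simp only [Pi.add_apply, Pi.smul_apply, smul_eq_mul]
            linarith)
        have e : (1 / 2 : ℝ) • (w + t • z + (w + (-t) • z)) = w := by
          module
        rw [e, hV.apply_self_add_smul, hV.apply_self_add_smul, h0, h1, h2, h3, h4, h5] at h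
        have ht2 : 0 < t ^ 2 := by positivity
        refine nonpos_of_mul_nonpos_right (a := t ^ 2) ?_ ht2
        linarith)
    simp only [ne_eq, OfNat.ofNat_ne_zero, not_false_eq_true, zero_pow, zero_mul, add_zero,
      sub_zero] at this
    linarith
  refine IsLorentz.of_pos (hV.swap45 w w w) hF fun z => ?_
  have h := main (z - (V w w w w z / V w w w w w) • w)
  simp only [map_sub, map_smul, LinearMap.sub_apply, LinearMap.smul_apply, smul_eq_mul,
    hV.swap45 w w w z w] at h ⊢
  rw [div_mul_cancel₀ _ hF.ne', sub_self] at h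
  have e := mul_div_cancel₀ (V w w w w z) hF.ne'
  linear_combination (1 / 4) * h + V w w w w z * e

lemma reverse_cauchy_schwarz (hV : V.IsMixed) {w y : Option ι → ℝ} (hw : 0 ≤ w) (hy : 0 ≤ y)
    (x : Option ι → ℝ) : V w w w x x * V w w w y y ≤ V w w w x y ^ 2 := by
  have := nonpos_at_zero_of_small (f := fun t =>
    V (w + t • 1) (w + t • 1) (w + t • 1) x x * V (w + t • 1) (w + t • 1) (w + t • 1) y y -
      V (w + t • 1) (w + t • 1) (w + t • 1) x y ^ 2) (by
      simp only [map_add, map_smul, LinearMap.add_apply, LinearMap.smul_apply, smul_eq_mul]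
      fun_prop) one_pos (fun t ht _ => by
        have hp : ∀ a, 0 < (w + t • (1 : Option ι → ℝ)) a := fun a => by
          have := hw a
          simp only [Pi.add_apply, Pi.smul_apply, smul_eq_mul, Pi.one_apply,
            Pi.zero_apply] at this ⊢
          linarith
        have hp0 : 0 ≤ w + t • (1 : Option ι → ℝ) := fun a => (hp a).le
        have := hV.isLorentz_self hp x y (hV.nonneg hp0 hp0 hp0 hy hy)
        linarith)
  simp only [zero_smul, add_zero] at this
  linarith

end QuintForm.IsMixed

namespace QuintForm.IsMixed

section

variable {ι : Type*} [DecidableEq ι] {V : QuintForm (Option ι)}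

lemma cube_add_smul (hV : V.IsMixed) (w z x y : Option ι → ℝ) (s : ℝ) :
    V (w + s • z) (w + s • z) (w + s • z) x y =
      V w w w x y + 3 * s * V w w z x y + 3 * s ^ 2 * V w z z x y + s ^ 3 * V z z z x y := by
  simp only [map_add, map_smul, LinearMap.add_apply, LinearMap.smul_apply, smul_eq_mul,
    hV.swap12 z w, hV.swap23 _ z w]
  ring

lemma pos_body_cube_single (hV : V.IsMixed) (a : Option ι) : 0 < V (Pi.single a 1)
    (Pi.single none 1) (Pi.single none 1) (Pi.single none 1) (Pi.single none 1) := by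
  rcases a with _ | i
  · exact hV.pos_body
  · rw [hV.swap12, hV.swap23, hV.swap34, hV.swap45]
    exact hV.pos_segment i

variable [Fintype ι]

lemma isLorentz_body_body_single (hV : V.IsMixed) (a : Option ι) :
    IsLorentz (V (Pi.single none 1) (Pi.single none 1) (Pi.single a 1)) := by
  set k : Option ι → ℝ := Pi.single none 1 with hk
  have hk0 : 0 ≤ k := single_nonneg none
  rcases a with _ | i
  · exact .of_pos (hV.swap45 _ _ _) (v := k) hV.pos_body fun x =>
      hV.reverse_cauchy_schwarz hk0 hk0 x
  · refine .of_pos (hV.swap45 _ _ _) (v := k) ?_ fun x => ?_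
    · rw [hV.swap23, hV.swap12]
      exact hV.pos_body_cube_single _
    · set e : Option ι → ℝ := Pi.single (some i) 1 with he
      have e0 : 0 ≤ e := single_nonneg _
      have z1 : ∀ x y, V k e e x y = 0 := fun x y => by
        rw [hV.swap12, hV.swap23, he, hV.segment_segment]; simp
      have z2 : ∀ x y, V e e e x y = 0 := fun x y => by
        rw [he, hV.segment_segment]; simp
      have := leading_coeff_nonpos (a := 0) (b := 0)
        (c := V k k k x x * V k k k k k - V k k k x k ^ 2)
        (d := 3 * (V k k k x x * V k k e k k + V k k e x x * V k k k k k
          - 2 * V k k k x k * V k k e x k))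
        (e := 9 * (V k k e x x * V k k e k k - V k k e x k ^ 2)) fun R hR => by
          have h := hV.reverse_cauchy_schwarz (w := k + R • e) (y := k)
            (add_nonneg hk0 (smul_nonneg hR.le e0)) hk0 x
          simp only [hV.cube_add_smul, z1, z2] at h
          nlinarith [sq_nonneg R]
      linarith

lemma isLorentz_body_single_single (hV : V.IsMixed) (i j : ι) :
    IsLorentz (V (Pi.single none 1) (Pi.single (some i) 1) (Pi.single (some j) 1)) := by
  set k : Option ι → ℝ := Pi.single none 1 with hk
  have hk0 : 0 ≤ k := single_nonneg none
  rcases eq_or_ne i j with rfl | hij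
  · intro x y _
    rw [hV.swap12, hV.swap23, hV.segment_segment]
    simpa using sq_nonneg _
  · refine .of_pos (hV.swap45 _ _ _) (v := k) ?_ fun x => ?_
    · have := hV.pos_segment_segment i j hij
      rwa [hV.swap34, hV.swap23, hV.swap45, hV.swap34] at this
    · set e : Option ι → ℝ := Pi.single (some i) 1 with he
      set f : Option ι → ℝ := Pi.single (some j) 1 with hf
      have e0 : 0 ≤ e := single_nonneg _
      have f0 : 0 ≤ f := single_nonneg _
      have ze : ∀ z x y, V e e z x y = 0 := fun z x y => by
        rw [he, hV.segment_segment]; simp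
      have zf : ∀ z x y, V f f z x y = 0 := fun z x y => by
        rw [hf, hV.segment_segment]; simp
      have z1 : ∀ x y, V k (e + f) (e + f) x y = 2 * V k e f x y := fun x y => by
        simp only [map_add, LinearMap.add_apply, hV.swap12 k, hV.swap23 _ k, ze, zf,
          hV.swap12 f e]
        ring
      have zef : ∀ x y, V e f f x y = 0 := fun x y => by rw [hV.swap12, hV.swap23, zf]
      have z2 : ∀ x y, V (e + f) (e + f) (e + f) x y = 0 := fun x y => by
        simp only [map_add, LinearMap.add_apply, hV.swap12 f e, hV.swap23 e f e, ze, zef, zf]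
        ring
      have := leading_coeff_nonpos
        (a := V k k k x x * V k k k k k - V k k k x k ^ 2)
        (b := 3 * (V k k k x x * V k k (e + f) k k + V k k (e + f) x x * V k k k k k
          - 2 * V k k k x k * V k k (e + f) x k))
        (c := 6 * (V k k k x x * V k e f k k + V k e f x x * V k k k k k
          - 2 * V k k k x k * V k e f x k) +
          9 * (V k k (e + f) x x * V k k (e + f) k k - V k k (e + f) x k ^ 2))
        (d := 18 * (V k k (e + f) x x * V k e f k k + V k e f x x * V k k (e + f) k k
          - 2 * V k k (e + f) x k * V k e f x k))
        (e := 36 * (V k e f x x * V k e f k k - V k e f x k ^ 2)) fun R hR => by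
          have h := hV.reverse_cauchy_schwarz (w := k + R • (e + f)) (y := k)
            (add_nonneg hk0 (smul_nonneg hR.le (add_nonneg e0 f0))) hk0 x
          simp only [hV.cube_add_smul, z1, z2] at h
          linarith
      linarith

lemma isLorentz_body_body (hV : V.IsMixed) {w : Option ι → ℝ} (hw : ∀ a, 0 < w a) :
    IsLorentz (V (Pi.single none 1) (Pi.single none 1) w) := by
  have hw0 : 0 ≤ w := fun a => (hw a).le
  refine .bochner (hV.swap34 _ _) (hV.swap45 _ _) (hV.nonneg_single _ _) hw
    hV.isLorentz_body_body_single (k := none) fun a => .inr ?_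
  rw [hV.swap23, hV.swap12]
  refine hV.pos_of_pos_body hw0 (hw _) (single_nonneg _) (single_nonneg _) (single_nonneg _)
    (single_nonneg _) ?_
  rw [hV.swap45, hV.swap34, hV.swap23, hV.swap12]
  exact hV.pos_body_cube_single a

lemma isLorentz_body_single (hV : V.IsMixed) {w : Option ι → ℝ} (hw : ∀ a, 0 < w a) (i : ι) :
    IsLorentz (V (Pi.single none 1) (Pi.single (some i) 1) w) := by
  have hw0 : 0 ≤ w := fun a => (hw a).le
  refine .bochner (hV.swap34 _ _) (hV.swap45 _ _) (hV.nonneg_single _ _) hw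
    (fun a => ?_) (k := none) fun a => ?_
  · rcases a with _ | j
    · have : V (Pi.single none 1) (Pi.single (some i) 1) (Pi.single none 1) =
          V (Pi.single none 1) (Pi.single none 1) (Pi.single (some i) 1) := by
        exact LinearMap.ext fun t => LinearMap.ext fun u => hV.swap23 _ _ _ _ _
      rw [this]
      exact hV.isLorentz_body_body_single _
    · exact hV.isLorentz_body_single_single i j
  · by_cases hij : a = some i
    · left
      refine LinearMap.ext fun t => LinearMap.ext fun u => ?_
      rw [hij, hV.swap12, hV.swap23, hV.segment_segment]
      simp
    · right
      rw [hV.swap23, hV.swap12]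
      refine hV.pos_of_pos_body hw0 (hw _) (single_nonneg _) (single_nonneg _) (single_nonneg _)
        (single_nonneg _) ?_
      rcases a with _ | j
      · rw [hV.swap23, hV.swap12]
        exact hV.pos_body_cube_single _
      · rw [hV.swap34]
        exact hV.pos_segment_segment i j fun h => hij (by rw [h])

lemma isLorentz_body (hV : V.IsMixed) {w : Option ι → ℝ} (hw : ∀ a, 0 < w a) :
    IsLorentz (V (Pi.single none 1) w w) := by
  have hw0 : 0 ≤ w := fun a => (hw a).le
  have hs : ∀ a : Option ι, V (Pi.single none 1) w (Pi.single a 1) =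
      V (Pi.single none 1) (Pi.single a 1) w := fun a => by
    exact LinearMap.ext fun t => LinearMap.ext fun u => hV.swap23 _ _ _ _ _
  refine .bochner (hV.swap34 _ _) (hV.swap45 _ _) (fun a b c => hV.nonneg (single_nonneg _) hw0
    (single_nonneg _) (single_nonneg _) (single_nonneg _)) hw
    (fun a => ?_) (k := none) fun a => .inr ?_
  · rw [hs]
    rcases a with _ | j
    · exact hV.isLorentz_body_body hw
    · exact hV.isLorentz_body_single hw j
  · rw [hV.swap12]
    refine hV.pos_of_pos_body hw0 (hw _) (single_nonneg _) hw0 (single_nonneg _)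
      (single_nonneg _) ?_
    rw [hV.swap23, hV.swap12]
    refine hV.pos_of_pos_body hw0 (hw _) (single_nonneg _) (single_nonneg _) (single_nonneg _)
      (single_nonneg _) ?_
    rw [hV.swap45, hV.swap34, hV.swap23, hV.swap12]
    exact hV.pos_body_cube_single a

/-- Log-concavity of the mixed volumes of the body and a positive combination of segments. -/
lemma log_concave_sequence (hV : V.IsMixed) {c : Option ι → ℝ} (hc0 : 0 ≤ c)
    (hc : ∀ i, 0 < c (some i)) {k : Option ι → ℝ} (hk : k = Pi.single none 1) :
    V k k k k k * V k k k c c ≤ V k k k k c ^ 2 ∧ V k k k k c * V k k c c c ≤ V k k k c c ^ 2 ∧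
    V k k k c c * V k c c c c ≤ V k k c c c ^ 2 ∧ V k k c c c * V c c c c c ≤ V k c c c c ^ 2 := by
  have hk0 : 0 ≤ k := hk ▸ single_nonneg none
  have hpos : ∀ t : ℝ, 0 < t → ∀ a, 0 < (c + t • k) a := by
    intro t ht a
    rcases a with _ | i
    · have := hc0 none
      simp only [Pi.add_apply, Pi.smul_apply, smul_eq_mul, hk, Pi.single_eq_same,
        Pi.zero_apply] at this ⊢
      linarith
    · simpa [hk] using hc i
  have hnn : ∀ t : ℝ, 0 < t → 0 ≤ c + t • k := fun t ht a => (hpos t ht a).le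
  refine ⟨?_, ?_, ?_, ?_⟩
  · have := hV.isLorentz_body_body_single none c k
      (by rw [← hk]; exact hV.nonneg hk0 hk0 hk0 hk0 hk0)
    rw [← hk, hV.swap45 k k k c k] at this
    linarith
  · have := nonpos_at_zero_of_small (f := fun t => V k k (c + t • k) k k * V k k (c + t • k) c c -
      V k k (c + t • k) k c ^ 2) (by
      simp only [map_add, map_smul, LinearMap.add_apply, LinearMap.smul_apply, smul_eq_mul]
      fun_prop) one_pos (fun t ht _ => by
        have := hV.isLorentz_body_body (hpos t ht) k c
          (by rw [← hk]; exact hV.nonneg hk0 hk0 (hnn t ht) hc0 hc0)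
        rw [← hk] at this
        linarith)
    simp only [zero_smul, add_zero, hV.swap34 _ _ c k, hV.swap45 _ _ _ c k] at this
    linarith
  · have := nonpos_at_zero_of_small (f := fun t => V k (c + t • k) (c + t • k) k k *
        V k (c + t • k) (c + t • k) c c - V k (c + t • k) (c + t • k) k c ^ 2) (by
      simp only [map_add, map_smul, LinearMap.add_apply, LinearMap.smul_apply, smul_eq_mul]
      fun_prop) one_pos (fun t ht _ => by
        have := hV.isLorentz_body (hpos t ht) k c
          (by rw [← hk]; exact hV.nonneg hk0 (hnn t ht) (hnn t ht) hc0 hc0)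
        rw [← hk] at this
        linarith)
    simp only [zero_smul, add_zero, hV.swap23 _ c k, hV.swap34 _ _ c k, hV.swap45 _ _ _ c k]
      at this
    linarith
  · have := hV.reverse_cauchy_schwarz hc0 hc0 k
    simp only [hV.swap12 c k, hV.swap23 _ c k, hV.swap34 _ _ c k, hV.swap45 _ _ _ c k] at this
    exact this

end

end QuintForm.IsMixed

/-- The one-dimensional Brunn-Minkowski inequality for compact sets. -/
lemma IsCompact.volume_add_le_volume_add {A B : Set ℝ} (hA : IsCompact A) (hB : IsCompact B)
    (hA0 : A.Nonempty) (hB0 : B.Nonempty) : volume A + volume B ≤ volume (A + B) := by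
  obtain ⟨a, ha, ham⟩ := hA.exists_isGreatest hA0
  obtain ⟨b, hb, hbm⟩ := hB.exists_isLeast hB0
  have h1 : volume ((fun x => x + b) '' A) = volume A := by
    rw [Set.image_add_right, measure_preimage_add_right]
  have h2 : volume ((fun x => a + x) '' B) = volume B := by
    rw [Set.image_add_left, measure_preimage_add]
  have hm : MeasurableSet ((fun x => a + x) '' B) :=
    (hB.image (by fun_prop)).measurableSet
  rw [← h1, ← h2, ← measure_union_add_inter _ hm]
  have h3 : ((fun x => x + b) '' A) ∩ ((fun x => a + x) '' B) ⊆ {a + b} := by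
    rintro _ ⟨⟨x, hx, rfl⟩, ⟨y, hy, hxy⟩⟩
    have := ham hx
    have := hbm hy
    simp only at hxy
    simp only [Set.mem_singleton_iff]
    linarith
  rw [measure_mono_null h3 (by simp), add_zero]
  refine measure_mono (Set.union_subset ?_ ?_)
  · rintro _ ⟨x, hx, rfl⟩
    exact Set.add_mem_add hx hb
  · rintro _ ⟨x, hx, rfl⟩
    exact Set.add_mem_add ha hx

lemma Real.volume_add_volume_le_of_midpoint {A B C : Set ℝ} (hA : MeasurableSet A)
    (hB : MeasurableSet B) (hA0 : A.Nonempty) (hB0 : B.Nonempty)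
    (h : ∀ x ∈ A, ∀ y ∈ B, (x + y) / 2 ∈ C) : volume A + volume B ≤ 2 * volume C := by
  have hC : volume ((fun x => x * 2⁻¹) ⁻¹' C) = 2 * volume C := by
    rw [Real.volume_preimage_mul_right (by norm_num)]
    norm_num
  have key : ∀ D : Set ℝ, MeasurableSet D → D.Nonempty → ∀ r < volume D, ∃ K ⊆ D, IsCompact K ∧
      K.Nonempty ∧ r < volume K := by
    intro D hD _ r hr
    obtain ⟨K, hK, hKc, hKr⟩ := hD.exists_lt_isCompact hr
    exact ⟨K, hK, hKc, nonempty_of_measure_ne_zero (ne_bot_of_gt hKr), hKr⟩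
  have key2 : ∀ D : Set ℝ, MeasurableSet D → D.Nonempty → ∀ m, (∀ K ⊆ D, IsCompact K →
      K.Nonempty → volume K ≤ m) → volume D ≤ m := by
    intro D hD hD0 m hm
    by_contra! hlt
    obtain ⟨K, h1, h2, h3, h4⟩ := key D hD hD0 m hlt
    exact absurd (hm K h1 h2 h3) (not_le.2 h4)
  rw [← hC]
  by_cases hCt : volume ((fun x => x * 2⁻¹) ⁻¹' C) = ⊤
  · rw [hCt]; exact le_top
  have step : ∀ K ⊆ A, IsCompact K → K.Nonempty → ∀ L ⊆ B, IsCompact L → L.Nonempty →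
      volume K + volume L ≤ volume ((fun x => x * 2⁻¹) ⁻¹' C) := by
    intro K hK hKc hK0 L hL hLc hL0
    refine (hKc.volume_add_le_volume_add hLc hK0 hL0).trans (measure_mono ?_)
    rintro _ ⟨x, hx, y, hy, rfl⟩
    exact h x (hK hx) y (hL hy)
  have step2 : ∀ K ⊆ A, IsCompact K → K.Nonempty →
      volume K + volume B ≤ volume ((fun x => x * 2⁻¹) ⁻¹' C) := by
    intro K hK hKc hK0
    have hK1 : volume K ≤ volume ((fun x => x * 2⁻¹) ⁻¹' C) := by
      obtain ⟨b, hb⟩ := hB0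
      exact le_self_add.trans (step K hK hKc hK0 {b} (by simpa) isCompact_singleton ⟨b, rfl⟩)
    rw [add_comm, ← ENNReal.le_sub_iff_add_le_right hKc.measure_ne_top hK1]
    refine key2 B hB hB0 _ fun L hL hLc hL0 => ?_
    rw [ENNReal.le_sub_iff_add_le_right hKc.measure_ne_top hK1, add_comm]
    exact step K hK hKc hK0 L hL hLc hL0
  have hB1 : volume B ≤ volume ((fun x => x * 2⁻¹) ⁻¹' C) := by
    obtain ⟨a, ha⟩ := hA0
    exact le_add_self.trans (step2 {a} (by simpa) isCompact_singleton ⟨a, rfl⟩)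
  have hBt : volume B ≠ ⊤ := ne_top_of_le_ne_top hCt hB1
  rw [← ENNReal.le_sub_iff_add_le_right hBt hB1]
  refine key2 A hA hA0 _ fun K hK hKc hK0 => ?_
  rw [ENNReal.le_sub_iff_add_le_right hBt hB1]
  exact step2 K hK hKc hK0

lemma lintegral_add_le_of_midpoint_of_sup_eq_one {f g h : ℝ → ℝ} (hf : Measurable f)
    (hg : Measurable g) (hh : Measurable h) (hf0 : ∀ x, 0 ≤ f x) (hg0 : ∀ x, 0 ≤ g x)
    (hh0 : ∀ x, 0 ≤ h x) (hf1 : ∀ x, f x ≤ 1) (hg1 : ∀ x, g x ≤ 1)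
    (hfs : ∀ t < 1, ∃ x, t < f x) (hgs : ∀ t < 1, ∃ x, t < g x)
    (hm : ∀ x y, f x * g y ≤ h ((x + y) / 2) ^ 2) :
    (∫⁻ x, ENNReal.ofReal (f x)) + ∫⁻ x, ENNReal.ofReal (g x) ≤
      2 * ∫⁻ x, ENNReal.ofReal (h x) := by
  rw [lintegral_eq_lintegral_meas_lt _ (.of_forall hf0) hf.aemeasurable,
    lintegral_eq_lintegral_meas_lt _ (.of_forall hg0) hg.aemeasurable,
    lintegral_eq_lintegral_meas_lt _ (.of_forall hh0) hh.aemeasurable,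
    ← lintegral_const_mul', ← lintegral_add_left]
  rotate_left
  · have : Antitone fun t => volume {a | t < f a} := fun a b hab =>
      measure_mono fun x hx => lt_of_le_of_lt hab hx
    exact this.measurable
  · simp
  refine setLIntegral_mono_ae' measurableSet_Ioi (.of_forall fun t ht => ?_)
  rcases lt_or_ge t 1 with ht1 | ht1
  · refine Real.volume_add_volume_le_of_midpoint (measurableSet_lt measurable_const hf)
      (measurableSet_lt measurable_const hg) (hfs t ht1) (hgs t ht1) fun x hx y hy => ?_
    simp only [Set.mem_ofPred_eq, Set.mem_Ioi] at hx hy ht ⊢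
    refine lt_of_pow_lt_pow_left₀ 2 (hh0 _) (lt_of_lt_of_le ?_ (hm x y))
    rw [sq]
    exact mul_lt_mul'' hx hy ht.le ht.le
  · have e1 : {a | t < f a} = ∅ := Set.eq_empty_of_forall_notMem fun x hx =>
      absurd (hf1 x) (not_le.2 (lt_of_le_of_lt ht1 hx))
    have e2 : {a | t < g a} = ∅ := Set.eq_empty_of_forall_notMem fun x hx =>
      absurd (hg1 x) (not_le.2 (lt_of_le_of_lt ht1 hx))
    simp [e1, e2]

lemma ENNReal.mul_le_sq_of_add_le_two_mul {a b c : ENNReal} (h : a + b ≤ 2 * c) :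
    a * b ≤ c ^ 2 := by
  by_cases hc : c = ⊤
  · simp [hc]
  have hs : a + b ≠ ⊤ := ne_top_of_le_ne_top (ENNReal.mul_ne_top (by simp) hc) h
  lift c to NNReal using hc
  lift a to NNReal using (ENNReal.add_ne_top.1 hs).1
  lift b to NNReal using (ENNReal.add_ne_top.1 hs).2
  norm_cast at h ⊢
  have h' : (a : ℝ) + b ≤ 2 * c := by exact_mod_cast h
  have : (a : ℝ) * b ≤ c ^ 2 := by
    nlinarith [sq_nonneg ((a : ℝ) - b), a.2, b.2, c.2, pow_le_pow_left₀ (add_nonneg a.2 b.2) h' 2]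
  exact_mod_cast this

/-- The one-dimensional Prékopa-Leindler inequality at the midpoint, for bounded functions. -/
lemma lintegral_mul_lintegral_le_of_midpoint {f g h : ℝ → ℝ} (hf : Measurable f)
    (hg : Measurable g) (hh : Measurable h) (hf0 : ∀ x, 0 ≤ f x) (hg0 : ∀ x, 0 ≤ g x)
    (hh0 : ∀ x, 0 ≤ h x) {M : ℝ} (hf1 : ∀ x, f x ≤ M) (hg1 : ∀ x, g x ≤ M)
    (hm : ∀ x y, f x * g y ≤ h ((x + y) / 2) ^ 2) :
    (∫⁻ x, ENNReal.ofReal (f x)) * ∫⁻ x, ENNReal.ofReal (g x) ≤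
      (∫⁻ x, ENNReal.ofReal (h x)) ^ 2 := by
  have main : ∀ f : ℝ → ℝ, (∀ x, 0 ≤ f x) → (∀ x, f x ≤ M) → (∀ x, f x = 0) ∨
      ∃ a > 0, (∀ x, f x / a ≤ 1) ∧ ∀ t < 1, ∃ x, t < f x / a := by
    intro f hf0 hf1
    have hb : BddAbove (Set.range f) := ⟨M, by rintro _ ⟨x, rfl⟩; exact hf1 x⟩
    rcases (hf0 0 |>.trans (le_ciSup hb 0)).eq_or_lt with h | h
    · exact .inl fun x => le_antisymm (h ▸ le_ciSup hb x) (hf0 x)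
    · refine .inr ⟨⨆ x, f x, h, fun x => (div_le_one h).2 (le_ciSup hb x), fun t ht => ?_⟩
      obtain ⟨x, hx⟩ := exists_lt_of_lt_ciSup (show t * ⨆ x, f x < ⨆ x, f x by nlinarith)
      exact ⟨x, (lt_div_iff₀ h).2 hx⟩
  rcases main f hf0 hf1 with h0 | ⟨a, ha, hfa, hfa'⟩
  · simp [h0]
  rcases main g hg0 hg1 with h0 | ⟨b, hb, hgb, hgb'⟩
  · simp [h0]
  have key := ENNReal.mul_le_sq_of_add_le_two_mul (lintegral_add_le_of_midpoint_of_sup_eq_one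
    (f := fun x => f x / a) (g := fun x => g x / b) (h := fun x => h x / √(a * b))
    (hf.div_const _) (hg.div_const _) (hh.div_const _) (fun x => div_nonneg (hf0 x) ha.le)
    (fun x => div_nonneg (hg0 x) hb.le) (fun x => div_nonneg (hh0 x) (Real.sqrt_nonneg _))
    hfa hgb hfa' hgb' fun x y => by
      rw [div_pow, Real.sq_sqrt (by positivity), div_mul_div_comm]
      exact div_le_div_of_nonneg_right (hm x y) (by positivity))
  have scale : ∀ (f : ℝ → ℝ) (a : ℝ), 0 < a → ∫⁻ x, ENNReal.ofReal (f x) =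
      ENNReal.ofReal a * ∫⁻ x, ENNReal.ofReal (f x / a) := by
    intro f a ha
    rw [← lintegral_const_mul' _ _ ENNReal.ofReal_ne_top]
    refine lintegral_congr fun x => ?_
    rw [← ENNReal.ofReal_mul ha.le, mul_div_cancel₀ _ ha.ne']
  rw [scale f a ha, scale g b hb, scale h (√(a * b)) (by positivity), mul_mul_mul_comm, mul_pow,
    ← ENNReal.ofReal_mul ha.le, ← ENNReal.ofReal_pow (Real.sqrt_nonneg _),
    Real.sq_sqrt (by positivity)]
  gcongr

lemma volume_eq_lintegral_cons {n : ℕ} {A : Set (Fin (n + 1) → ℝ)} (hA : MeasurableSet A) :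
    volume A = ∫⁻ x : ℝ, volume {y : Fin n → ℝ | Fin.cons x y ∈ A} := by
  have h := (volume_preserving_piFinSuccAbove (fun _ : Fin (n + 1) => ℝ) 0).symm
  rw [← h.measure_preimage hA.nullMeasurableSet, Measure.volume_eq_prod,
    Measure.prod_apply (h.measurable hA)]
  refine lintegral_congr fun x => congrArg _ (Set.ext fun y => ?_)
  simp [MeasurableEquiv.piFinSuccAbove, Fin.insertNthEquiv]

/-- The multiplicative Brunn-Minkowski inequality at the midpoint. -/
lemma volume_mul_volume_le_of_midpoint {n : ℕ} {A B C : Set (Fin n → ℝ)} (hA : MeasurableSet A)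
    (hB : MeasurableSet B) (hC : MeasurableSet C) {R : ℝ} (hAR : A ⊆ closedBall 0 R)
    (hBR : B ⊆ closedBall 0 R) (hCR : C ⊆ closedBall 0 R)
    (h : ∀ x ∈ A, ∀ y ∈ B, (1 / 2 : ℝ) • (x + y) ∈ C) : volume A * volume B ≤ volume C ^ 2 := by
  induction n with
  | zero =>
    rcases A.eq_empty_or_nonempty with rfl | ⟨a, ha⟩
    · simp
    rcases B.eq_empty_or_nonempty with rfl | ⟨b, hb⟩
    · simp
    have : C = Set.univ := Subsingleton.eq_univ_of_nonempty ⟨_, h a ha b hb⟩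
    rw [this, sq]
    gcongr <;> exact Set.subset_univ _
  | succ n ih =>
    have slice : ∀ D : Set (Fin (n + 1) → ℝ), MeasurableSet D → D ⊆ closedBall 0 R →
        (∀ x : ℝ, MeasurableSet {y : Fin n → ℝ | Fin.cons x y ∈ D}) ∧
        (∀ x : ℝ, {y : Fin n → ℝ | Fin.cons x y ∈ D} ⊆ closedBall 0 R) ∧
        (∀ x : ℝ, volume {y : Fin n → ℝ | Fin.cons x y ∈ D} ≠ ⊤) ∧
        Measurable (fun x : ℝ => volume {y : Fin n → ℝ | Fin.cons x y ∈ D}) := by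
      intro D hD hDR
      have hm : Measurable (fun p : ℝ × (Fin n → ℝ) => (Fin.cons p.1 p.2 : Fin (n + 1) → ℝ)) := by
        refine measurable_pi_iff.2 fun i => ?_
        refine Fin.cases ?_ (fun j => ?_) i
        · exact measurable_fst
        · exact (measurable_pi_apply j).comp measurable_snd
      have h2 : ∀ x : ℝ, {y : Fin n → ℝ | Fin.cons x y ∈ D} ⊆ closedBall 0 R := by
        intro x y hy
        have := hDR hy
        rw [mem_closedBall_zero_iff] at this ⊢
        have hR : 0 ≤ R := (norm_nonneg _).trans this
        refine (pi_norm_le_iff_of_nonneg hR).2 fun i => ?_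
        exact (norm_le_pi_norm (Fin.cons x y : Fin (n + 1) → ℝ) i.succ).trans this
      exact ⟨fun x => (hm.comp measurable_prodMk_left) hD, h2,
        fun x => measure_ne_top_of_subset (h2 x) measure_closedBall_lt_top.ne,
        measurable_measure_prodMk_left (hm hD)⟩
    obtain ⟨a1, a2, a3, a4⟩ := slice A hA hAR
    obtain ⟨b1, b2, b3, b4⟩ := slice B hB hBR
    obtain ⟨c1, c2, c3, c4⟩ := slice C hC hCR
    have key := lintegral_mul_lintegral_le_of_midpoint a4.ennreal_toReal b4.ennreal_toReal
      c4.ennreal_toReal (fun _ => ENNReal.toReal_nonneg) (fun _ => ENNReal.toReal_nonneg)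
      (fun _ => ENNReal.toReal_nonneg)
      (M := (volume (closedBall (0 : Fin n → ℝ) R)).toReal)
      (fun x => ENNReal.toReal_mono measure_closedBall_lt_top.ne (measure_mono (a2 x)))
      (fun x => ENNReal.toReal_mono measure_closedBall_lt_top.ne (measure_mono (b2 x)))
      (fun x y => by
        rw [← ENNReal.toReal_mul, ← ENNReal.toReal_pow]
        refine ENNReal.toReal_mono (ENNReal.pow_ne_top (c3 _)) ?_
        refine ih (a1 x) (b1 y) (c1 _) (a2 x) (b2 y) (c2 _) fun u hu v hv => ?_
        have := h _ hu _ hv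
        simp only [Set.mem_ofPred_eq]
        convert this using 1
        ext i
        refine Fin.cases ?_ (fun j => ?_) i
        · simp; ring
        · simp; ring)
    simp only [ENNReal.ofReal_toReal (a3 _), ENNReal.ofReal_toReal (b3 _),
      ENNReal.ofReal_toReal (c3 _)] at key
    rwa [volume_eq_lintegral_cons hA, volume_eq_lintegral_cons hB, volume_eq_lintegral_cons hC]

/-- The multiplicative Brunn-Minkowski inequality for compact sets. -/
lemma IsCompact.volume_mul_volume_le {n : ℕ} {A B : Set (EuclideanSpace ℝ (Fin n))}
    (hA : IsCompact A) (hB : IsCompact B) :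
    volume A * volume B ≤ volume ((1 / 2 : ℝ) • (A + B)) ^ 2 := by
  have h := PiLp.volume_preserving_toLp (Fin n)
  have hc : Continuous (WithLp.toLp 2 : (Fin n → ℝ) → EuclideanSpace ℝ (Fin n)) := by fun_prop
  have hc' : Continuous (WithLp.ofLp : EuclideanSpace ℝ (Fin n) → (Fin n → ℝ)) := by fun_prop
  have hcomp : ∀ D : Set (EuclideanSpace ℝ (Fin n)), IsCompact D →
      IsCompact ((WithLp.toLp 2 : (Fin n → ℝ) → _) ⁻¹' D) := by
    intro D hD
    convert hD.image hc' using 1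
    ext x
    constructor
    · intro hx; exact ⟨_, hx, rfl⟩
    · rintro ⟨y, hy, rfl⟩; exact hy
  have hC : IsCompact ((1 / 2 : ℝ) • (A + B)) := (hA.add hB).smul _
  rw [← h.measure_preimage hA.measurableSet.nullMeasurableSet,
    ← h.measure_preimage hB.measurableSet.nullMeasurableSet,
    ← h.measure_preimage hC.measurableSet.nullMeasurableSet]
  obtain ⟨R, hR⟩ :=
    (((hcomp A hA).union (hcomp B hB)).union (hcomp _ hC)).isBounded.subset_closedBall 0
  rw [Set.union_subset_iff, Set.union_subset_iff] at hR
  refine volume_mul_volume_le_of_midpoint (hcomp A hA).measurableSet (hcomp B hB).measurableSet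
    (hcomp _ hC).measurableSet hR.1.1 hR.1.2 hR.2 fun x hx y hy => ?_
  exact Set.smul_mem_smul_set (Set.add_mem_add hx hy)

lemma eq_mul_of_additive_nonneg {f : ℝ → ℝ} (h0 : ∀ s, 0 ≤ s → 0 ≤ f s)
    (hadd : ∀ s r, 0 ≤ s → 0 ≤ r → f (s + r) = f s + f r) {t : ℝ} (ht : 0 ≤ t) :
    f t = t * f 1 := by
  have hz : f 0 = 0 := by have := hadd 0 0 le_rfl le_rfl; simp at this; exact this
  have hmono : ∀ s r, 0 ≤ s → s ≤ r → f s ≤ f r := by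
    intro s r hs hr
    have := hadd s (r - s) hs (by linarith)
    rw [add_sub_cancel] at this
    have := h0 (r - s) (by linarith)
    linarith
  have hnat : ∀ (N : ℕ) (s : ℝ), 0 ≤ s → f (N * s) = N * f s := by
    intro N s hs
    induction N with
    | zero => simp [hz]
    | succ N ih =>
      push_cast
      rw [add_mul, one_mul, hadd _ _ (by positivity) hs, ih]
      ring
  have key : ∀ N : ℕ, N * |f t - t * f 1| ≤ f 1 := by
    intro N
    have h1 := Nat.floor_le (show 0 ≤ N * t by positivity)
    have h2 := (Nat.lt_floor_add_one (N * t)).le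
    have h3 := hmono _ _ (Nat.cast_nonneg _) h1
    have h4 := hmono _ _ (show 0 ≤ N * t by positivity) h2
    have h5 := hnat ⌊N * t⌋₊ 1 zero_le_one
    have h6 := hnat (⌊N * t⌋₊ + 1) 1 zero_le_one
    rw [mul_one] at h5 h6
    push_cast at h6
    rw [hnat N t ht] at h3 h4
    rw [h5] at h3
    rw [h6] at h4
    have h7 := h0 1 zero_le_one
    rw [show N * |f t - t * f 1| = |N * (f t - t * f 1)| by rw [abs_mul, Nat.abs_cast], abs_le]
    constructor <;> nlinarith
  by_contra hne
  have hpos : 0 < |f t - t * f 1| := abs_pos.2 (sub_ne_zero.2 hne)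
  obtain ⟨N, hN⟩ := exists_nat_gt (f 1 / |f t - t * f 1|)
  rw [div_lt_iff₀ hpos] at hN
  exact absurd (key N) (not_le.2 hN)

section Zonotope

variable {ι E : Type*} [Fintype ι] [AddCommGroup E] [Module ℝ E]

/-- The Minkowski sum of the segments from `0` to `s i • u i`. -/
def zonotope (u : ι → E) (s : ι → ℝ) : Set E :=
  (fun a : ι → ℝ => ∑ i, a i • u i) '' Set.Icc 0 s

lemma zonotope_add (u : ι → E) {s r : ι → ℝ} (hs : 0 ≤ s) (hr : 0 ≤ r) :
    zonotope u (s + r) = zonotope u s + zonotope u r := by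
  ext x
  constructor
  · rintro ⟨a, ⟨ha0, ha⟩, rfl⟩
    refine ⟨_, ⟨fun i => min (a i) (s i), ⟨fun i => le_min (ha0 i) (hs i),
      fun i => min_le_right _ _⟩, rfl⟩, _, ⟨fun i => a i - min (a i) (s i),
      ⟨fun i => sub_nonneg.2 (min_le_left _ _), fun i => ?_⟩, rfl⟩, ?_⟩
    · have h1 := ha i
      simp only [Pi.add_apply] at h1
      have h2 := hr i
      simp only [Pi.zero_apply] at h2
      rcases min_choice (a i) (s i) with h | h <;> simp only [h] <;> linarith
    · simp only [← Finset.sum_add_distrib, ← add_smul, add_sub_cancel]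
  · rintro ⟨_, ⟨a, ha, rfl⟩, _, ⟨b, hb, rfl⟩, rfl⟩
    refine ⟨a + b, ⟨add_nonneg ha.1 hb.1, add_le_add ha.2 hb.2⟩, ?_⟩
    simp only [Pi.add_apply, add_smul, Finset.sum_add_distrib]

lemma zonotope_smul (u : ι → E) {s : ι → ℝ} {c : ℝ} (hc : 0 < c) :
    zonotope u (c • s) = c • zonotope u s := by
  ext x
  constructor
  · rintro ⟨a, ha, rfl⟩
    refine ⟨_, ⟨c⁻¹ • a, ⟨smul_nonneg (inv_nonneg.2 hc.le) ha.1, ?_⟩, rfl⟩, ?_⟩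
    · have := smul_le_smul_of_nonneg_left ha.2 (inv_nonneg.2 hc.le)
      rwa [inv_smul_smul₀ hc.ne'] at this
    · simp only [Finset.smul_sum, Pi.smul_apply, smul_smul, smul_eq_mul,
        mul_inv_cancel_left₀ hc.ne']
  · rintro ⟨_, ⟨a, ha, rfl⟩, rfl⟩
    refine ⟨c • a, ⟨smul_nonneg hc.le ha.1, smul_le_smul_of_nonneg_left ha.2 hc.le⟩, ?_⟩
    simp only [Finset.smul_sum, Pi.smul_apply, smul_smul, smul_eq_mul]

lemma zonotope_zero (u : ι → E) : zonotope u 0 = {0} := by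
  simp [zonotope]

lemma zonotope_single [DecidableEq ι] (u : ι → E) (i : ι) (t : ℝ) :
    zonotope u (Pi.single i t) = (fun a : ℝ => a • u i) '' Set.Icc 0 t := by
  ext x
  constructor
  · rintro ⟨a, ha, rfl⟩
    refine ⟨a i, ⟨ha.1 i, by simpa using ha.2 i⟩, ?_⟩
    refine (Finset.sum_eq_single (f := fun j => a j • u j) i (fun j _ hj => ?_)
      fun h => absurd (Finset.mem_univ i) h).symm
    have h1 := ha.1 j
    have h2 := ha.2 j
    simp only [Pi.single_eq_of_ne hj, Pi.zero_apply] at h1 h2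
    simp only [le_antisymm h2 h1, zero_smul]
  · rintro ⟨a, ha, rfl⟩
    refine ⟨Pi.single i a, ⟨Pi.single_nonneg.2 ha.1, Pi.single_mono i ha.2⟩, ?_⟩
    simp [Pi.single_apply, ite_smul]

lemma convex_zonotope (u : ι → E) (s : ι → ℝ) : Convex ℝ (zonotope u s) :=
  (convex_Icc 0 s).is_linear_image
    ⟨fun a b => by simp [add_smul, Finset.sum_add_distrib],
      fun c a => by simp [Finset.smul_sum, smul_smul]⟩

lemma isCompact_zonotope [TopologicalSpace E] [ContinuousAdd E] [ContinuousSMul ℝ E] (u : ι → E)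
    (s : ι → ℝ) : IsCompact (zonotope u s) :=
  isCompact_Icc.image (by fun_prop)

end Zonotope

section Affine

variable {E : Type*} [NormedAddCommGroup E] [NormedSpace ℝ E]
  [MeasurableSpace E] [BorelSpace E] (μ : Measure E) [μ.IsAddHaarMeasure]

/-- The volume of the sum of a compact convex set and a segment is affine in the length of the
segment. -/
lemma measureReal_add_segment_eq {M : Set E} (hM : IsCompact M) (hMc : Convex ℝ M) (u : E) {t : ℝ}
    (ht : 0 ≤ t) : μ.real (M + (fun a : ℝ => a • u) '' Set.Icc 0 t) =
      (1 - t) * μ.real M + t * μ.real (M + (fun a : ℝ => a • u) '' Set.Icc 0 1) := by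
  set N : ℝ → Set E := fun s => M + (fun a : ℝ => a • u) '' Set.Icc 0 s with hN
  have hNc : ∀ s, IsCompact (N s) := fun s => hM.add (isCompact_Icc.image (by fun_prop))
  have hfin : ∀ s, μ (N s) ≠ ⊤ := fun s => (hNc s).measure_ne_top
  have hsub : ∀ s, 0 ≤ s → M ⊆ N s := fun s hs x hx =>
    ⟨x, hx, 0, ⟨0, ⟨le_rfl, hs⟩, by simp⟩, by simp⟩
  have hmono : ∀ s r, s ≤ r → N s ⊆ N r := fun s r h =>
    Set.add_subset_add_left (Set.image_mono (Set.Icc_subset_Icc_right h))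
  have hdiff : ∀ s r, 0 ≤ s → 0 ≤ r → N (s + r) \ N s = (fun x => x + s • u) '' (N r \ M) := by
    intro s r hs hr
    ext x
    constructor
    · rintro ⟨⟨m, hm, _, ⟨a, ⟨ha0, ha⟩, rfl⟩, rfl⟩, hx⟩
      have has : s < a := by
        by_contra! h
        exact hx ⟨m, hm, _, ⟨a, ⟨ha0, h⟩, rfl⟩, rfl⟩
      refine ⟨m + (a - s) • u, ⟨⟨m, hm, _, ⟨a - s, ⟨by linarith, by linarith⟩, rfl⟩, rfl⟩,
        fun h => hx ⟨_, h, _, ⟨s, ⟨hs, le_rfl⟩, rfl⟩, ?_⟩⟩, ?_⟩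
      · simp only; module
      · simp only; module
    · rintro ⟨_, ⟨⟨m, hm, _, ⟨a, ⟨ha0, ha⟩, rfl⟩, rfl⟩, hx⟩, rfl⟩
      refine ⟨⟨m, hm, _, ⟨a + s, ⟨by linarith, by linarith⟩, rfl⟩, by simp only; module⟩, ?_⟩
      rintro ⟨m', hm', _, ⟨b, ⟨hb0, hb⟩, rfl⟩, hmb⟩
      simp only at hmb hx
      have e1 : m' = m + (a + (s - b)) • u := by
        rw [← sub_eq_zero] at hmb ⊢
        rw [← hmb]
        module
      rcases ha0.eq_or_lt with h | h
      · rw [← h] at hx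
        simp [hm] at hx
      · apply hx
        have hp : 0 < a + (s - b) := by linarith
        have := hMc hm hm' (a := (s - b) / (a + (s - b))) (b := a / (a + (s - b)))
          (div_nonneg (by linarith) hp.le) (div_nonneg ha0 hp.le) (by field_simp; ring)
        convert this using 1
        rw [e1, smul_add, ← add_assoc, ← add_smul, smul_smul]
        congr 1
        · rw [← add_div, show s - b + a = a + (s - b) by ring, div_self hp.ne', one_smul]
        · rw [div_mul_cancel₀ _ hp.ne']
  have hadd : ∀ s r, 0 ≤ s → 0 ≤ r →
      μ.real (N (s + r)) - μ.real (N s) = μ.real (N r) - μ.real M := by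
    intro s r hs hr
    rw [← measureReal_sdiff (hmono _ _ (by linarith)) (hNc s).measurableSet (hfin _),
      ← measureReal_sdiff (hsub r hr) hM.measurableSet (hfin _), hdiff s r hs hr]
    rw [Set.image_add_right]
    simp only [measureReal_def, measure_preimage_add_right]
  have hN0 : N 0 = M := by simp [hN]
  have key := eq_mul_of_additive_nonneg (f := fun s => μ.real (N s) - μ.real M)
    (fun s hs => sub_nonneg.2 (measureReal_mono (hsub s hs) (hfin s)))
    (fun s r hs hr => by have := hadd s r hs hr; linarith) ht
  linarith

end Affine

lemma exists_coeff_of_multiaffine {ι : Type*} [DecidableEq ι] (J : Finset ι) (f : (ι → ℝ) → ℝ)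
    (hf : ∀ i s t, 0 ≤ s → 0 ≤ t → f (Function.update s i t) =
      (1 - t) * f (Function.update s i 0) + t * f (Function.update s i 1)) :
    ∃ A : Finset ι → ℝ, ∀ s, 0 ≤ s → (∀ i ∉ J, s i = 0) →
      f s = ∑ S ∈ J.powerset, A S * ∏ i ∈ S, s i := by
  induction J using Finset.induction_on generalizing f with
  | empty =>
    refine ⟨fun _ => f 0, fun s _ h => ?_⟩
    have : s = 0 := funext fun i => h i (by simp)
    simp [this]
  | insert j J hj ih =>
    have hup : ∀ (s : ι → ℝ) (j : ι) (a : ℝ), 0 ≤ s → 0 ≤ a → 0 ≤ Function.update s j a :=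
      fun s j a hs ha i => by
        rcases eq_or_ne i j with rfl | h
        · simpa using ha
        · simpa [h] using hs i
    obtain ⟨A, hA⟩ := ih f hf
    obtain ⟨B, hB⟩ := ih (fun s => f (Function.update s j 1) - f (Function.update s j 0)) (by
      intro i s t hs ht
      rcases eq_or_ne i j with rfl | hij
      · simp only [Function.update_idem]
        ring
      · simp only [Function.update_comm hij]
        rw [hf i _ t (hup s j 1 hs zero_le_one) ht, hf i _ t (hup s j 0 hs le_rfl) ht]
        ring)
    refine ⟨fun S => if j ∈ S then B (S.erase j) else A S, fun s hs h => ?_⟩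
    have h0 : 0 ≤ Function.update s j 0 := hup s j 0 hs le_rfl
    have h1 : ∀ i ∉ J, Function.update s j 0 i = 0 := by
      intro i hi
      rcases eq_or_ne i j with rfl | hij
      · simp
      · simpa [hij] using h i (by simp [hij, hi])
    have e := hf j s (s j) hs (hs j)
    rw [Function.update_eq_self] at e
    have e1 := hA _ h0 h1
    have e2 := hB _ h0 h1
    simp only [Function.update_idem] at e2
    have hprod : ∀ S ∈ J.powerset, ∏ i ∈ S, Function.update s j 0 i = ∏ i ∈ S, s i := by
      intro S hS
      refine Finset.prod_congr rfl fun i hi => Function.update_of_ne ?_ _ _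
      rintro rfl
      exact hj (Finset.mem_powerset.1 hS hi)
    rw [Finset.sum_powerset_insert hj]
    have e3 : f s = f (Function.update s j 0) +
        s j * (f (Function.update s j 1) - f (Function.update s j 0)) := by linarith
    rw [e3, e2, e1, Finset.mul_sum]
    refine congrArg₂ _ (Finset.sum_congr rfl fun S hS => ?_) (Finset.sum_congr rfl fun S hS => ?_)
    · have : j ∉ S := fun h => hj (Finset.mem_powerset.1 hS h)
      beta_reduce
      rw [hprod S hS, if_neg this]
    · have : j ∉ S := fun h => hj (Finset.mem_powerset.1 hS h)
      beta_reduce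
      rw [hprod S hS, if_pos (Finset.mem_insert_self _ _), Finset.erase_insert this,
        Finset.prod_insert this]
      ring

/-- The coefficients of a multiaffine polynomial are its growth rates. -/
lemma tendsto_coeff_of_multiaffine {ι : Type*} [Fintype ι] [DecidableEq ι] {f : (ι → ℝ) → ℝ}
    {A : Finset ι → ℝ} (h : ∀ s, 0 ≤ s → f s = ∑ S, A S * ∏ i ∈ S, s i) (S : Finset ι) :
    Filter.Tendsto (fun R : ℝ => f (fun i => if i ∈ S then R else 0) / R ^ S.card) Filter.atTop
      (nhds (A S)) := by
  have h1 : ∀ T : Finset ι, Filter.Tendsto (fun R : ℝ =>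
      (A T * ∏ i ∈ T, if i ∈ S then R else 0) / R ^ S.card) Filter.atTop
      (nhds (if T = S then A S else 0)) := by
    intro T
    by_cases hTS : T ⊆ S
    · have e : ∀ R : ℝ, (∏ i ∈ T, if i ∈ S then R else 0) = R ^ T.card := fun R => by
        rw [Finset.prod_congr rfl fun i hi => if_pos (hTS hi), Finset.prod_const]
      simp only [e]
      rcases eq_or_ne T S with rfl | hne
      · rw [if_pos rfl]
        refine tendsto_const_nhds.congr' ?_
        filter_upwards [Filter.eventually_gt_atTop 0] with R hR
        field_simp
      · rw [if_neg hne]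
        have hlt : T.card < S.card := Finset.card_lt_card (hTS.ssubset_of_ne hne)
        have := (tendsto_pow_neg_atTop (𝕜 := ℝ) (n := S.card - T.card) (by omega)).const_mul (A T)
        rw [mul_zero] at this
        refine this.congr' ?_
        filter_upwards [Filter.eventually_gt_atTop 0] with R hR
        rw [zpow_neg, zpow_natCast, pow_sub₀ _ hR.ne' hlt.le]
        field_simp
    · have hne : T ≠ S := fun h => hTS h.subset
      obtain ⟨j, hjT, hjS⟩ := Finset.not_subset.1 hTS
      have e : ∀ R : ℝ, (∏ i ∈ T, if i ∈ S then R else 0) = 0 := fun R =>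
        Finset.prod_eq_zero hjT (if_neg hjS)
      simp only [e, mul_zero, zero_div, if_neg hne]
      exact tendsto_const_nhds
  have h2 := tendsto_finsetSum Finset.univ fun T _ => h1 T
  simp only [Finset.sum_ite_eq', Finset.mem_univ, if_true] at h2
  refine h2.congr' ?_
  filter_upwards [Filter.eventually_gt_atTop 0] with R hR
  rw [h _ (fun i => by dsimp only; split_ifs <;> simp [hR.le]), Finset.sum_div]

section

variable {n : ℕ} {ι : Type*} [Fintype ι] {K : Set (EuclideanSpace ℝ (Fin n))}
  (u : ι → EuclideanSpace ℝ (Fin n))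

lemma volume_add_zonotope_update [DecidableEq ι] (hK : IsCompact K) (hKc : Convex ℝ K) (i : ι)
    (s : ι → ℝ) (t : ℝ) (hs : 0 ≤ s) (ht : 0 ≤ t) :
    volume.real (K + zonotope u (Function.update s i t)) =
      (1 - t) * volume.real (K + zonotope u (Function.update s i 0)) +
        t * volume.real (K + zonotope u (Function.update s i 1)) := by
  have hup : 0 ≤ Function.update s i 0 := fun j => by
    rcases eq_or_ne j i with rfl | h
    · simp
    · simpa [h] using hs j
  have e : ∀ a, 0 ≤ a → K + zonotope u (Function.update s i a) =
      K + zonotope u (Function.update s i 0) + (fun b : ℝ => b • u i) '' Set.Icc 0 a := by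
    intro a ha
    rw [← zonotope_single, add_assoc, ← zonotope_add u hup (Pi.single_nonneg.2 ha)]
    congr 2
    ext j
    rcases eq_or_ne j i with rfl | h
    · simp
    · simp [h]
  rw [e t ht, e 1 zero_le_one]
  exact measureReal_add_segment_eq volume (hK.add (isCompact_zonotope u _))
    (hKc.add (convex_zonotope u _)) (u i) ht

/-- The volume of the sum of a convex body and segments is a multiaffine polynomial in the lengths
of the segments, with nonnegative coefficients. -/
lemma exists_coeff_volume_add_zonotope [DecidableEq ι] (hK : IsCompact K) (hKc : Convex ℝ K) :
    ∃ A : Finset ι → ℝ,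
      (∀ s, 0 ≤ s → volume.real (K + zonotope u s) = ∑ S, A S * ∏ i ∈ S, s i) ∧
      (∀ S, 0 ≤ A S) ∧ (∀ S, n < S.card → A S = 0) ∧ ∀ (S : Finset ι) (c : ℝ),
        (∀ R : ℝ, 1 ≤ R → c * R ^ S.card ≤
          volume.real (K + zonotope u (fun i => if i ∈ S then R else 0))) → c ≤ A S := by
  obtain ⟨A, hA⟩ := exists_coeff_of_multiaffine Finset.univ
    (fun s => volume.real (K + zonotope u s)) (volume_add_zonotope_update u hK hKc)
  have hA' : ∀ s, 0 ≤ s → volume.real (K + zonotope u s) = ∑ S, A S * ∏ i ∈ S, s i := by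
    intro s hs
    simpa using hA s hs (by simp)
  have hlim := tendsto_coeff_of_multiaffine hA'
  have hnn : ∀ S, 0 ≤ A S := fun S => by
    refine ge_of_tendsto (hlim S) ?_
    filter_upwards [Filter.eventually_gt_atTop 0] with R hR
    exact div_nonneg measureReal_nonneg (by positivity)
  refine ⟨A, hA', hnn, fun S hS => le_antisymm ?_ (hnn S), fun S c hc => ?_⟩
  · obtain ⟨ρ, hρ⟩ := hK.isBounded.subset_closedBall 0
    set C : ℝ := volume.real (closedBall (0 : EuclideanSpace ℝ (Fin n)) ρ +
      zonotope u (fun i => if i ∈ S then 1 else 0))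
    have hbound : ∀ R : ℝ, 1 ≤ R →
        volume.real (K + zonotope u (fun i => if i ∈ S then R else 0)) ≤ C * R ^ n := by
      intro R hR
      have hR0 : 0 < R := by linarith
      have e : (fun i => if i ∈ S then R else 0) = R • fun i => if i ∈ S then (1 : ℝ) else 0 := by
        ext i; simp
      have hsub : K + zonotope u (fun i => if i ∈ S then R else 0) ⊆
          R • (closedBall (0 : EuclideanSpace ℝ (Fin n)) ρ +
            zonotope u (fun i => if i ∈ S then 1 else 0)) := by
        rw [e, zonotope_smul u hR0, smul_add]
        refine Set.add_subset_add_right fun x hx => ?_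
        refine ⟨R⁻¹ • x, ?_, by simp [smul_smul, hR0.ne']⟩
        have := hρ hx
        rw [mem_closedBall_zero_iff] at this ⊢
        rw [norm_smul, Real.norm_of_nonneg (by positivity)]
        refine (mul_le_of_le_one_left (norm_nonneg _) ?_).trans this
        exact inv_le_one_of_one_le₀ hR
      have hc : IsCompact (R • (closedBall (0 : EuclideanSpace ℝ (Fin n)) ρ +
            zonotope u (fun i => if i ∈ S then 1 else 0))) :=
        ((isCompact_closedBall _ _).add (isCompact_zonotope u _)).smul R
      refine (measureReal_mono hsub hc.measure_ne_top).trans_eq ?_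
      rw [measureReal_def, Measure.addHaar_smul, ENNReal.toReal_mul,
        ENNReal.toReal_ofReal (abs_nonneg _), finrank_euclideanSpace_fin,
        abs_of_pos (by positivity), mul_comm]
      rfl
    have h0 := (tendsto_pow_neg_atTop (𝕜 := ℝ) (n := S.card - n) (by omega)).const_mul C
    rw [mul_zero] at h0
    refine le_of_tendsto_of_tendsto (hlim S) h0 ?_
    filter_upwards [Filter.eventually_ge_atTop 1] with R hR
    have hR0 : 0 < R := by linarith
    rw [zpow_neg, zpow_natCast, pow_sub₀ _ hR0.ne' hS.le, div_le_iff₀ (by positivity)]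
    refine (hbound R hR).trans_eq ?_
    field_simp
  · refine ge_of_tendsto (hlim S) ?_
    filter_upwards [Filter.eventually_ge_atTop 1] with R hR
    rw [le_div_iff₀ (by positivity)]
    exact hc R hR

end

section

variable {n : ℕ} {ι : Type*} [Fintype ι] {K : Set (EuclideanSpace ℝ (Fin n))}

lemma mul_volume_le_volume_add_segment (hK : IsCompact K) (ℓ : EuclideanSpace ℝ (Fin n) →ₗ[ℝ] ℝ)
    {u : EuclideanSpace ℝ (Fin n)} (hu : ℓ u = 1) {δ : ℝ} (hδ : 0 < δ) (h : ∀ y ∈ K, |ℓ y| ≤ δ)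
    {R : ℝ} (hR : 0 ≤ R) :
    R / (2 * δ) * volume.real K ≤ volume.real (K + (fun b : ℝ => b • u) '' Set.Icc 0 R) := by
  set b := R / (2 * δ)
  have hb : 0 ≤ b := by positivity
  have hbR : b * (2 * δ) = R := div_mul_cancel₀ _ (by positivity)
  have hsub : (b * δ) • u +ᵥ (LinearMap.transvection ℓ (b • u)) '' K ⊆
      K + (fun b : ℝ => b • u) '' Set.Icc 0 R := by
    rintro _ ⟨_, ⟨y, hy, rfl⟩, rfl⟩
    have h1 := abs_le.1 (h y hy)
    refine ⟨y, hy, (b * (δ + ℓ y)) • u, ⟨_, ⟨mul_nonneg hb (by linarith), ?_⟩, rfl⟩, ?_⟩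
    · rw [← hbR]
      exact mul_le_mul_of_nonneg_left (by linarith) hb
    · simp only [LinearMap.transvection.apply, vadd_eq_add]
      module
  have hc : IsCompact (K + (fun b : ℝ => b • u) '' Set.Icc 0 R) :=
    hK.add (isCompact_Icc.image (by fun_prop))
  refine le_trans ?_ (measureReal_mono hsub hc.measure_ne_top)
  rw [measureReal_def volume (_ +ᵥ _), measure_vadd, Measure.addHaar_image_linearMap,
    ENNReal.toReal_mul, ENNReal.toReal_ofReal (abs_nonneg _), LinearMap.transvection.det, map_smul,
    hu, smul_eq_mul, mul_one]
  exact mul_le_mul_of_nonneg_right ((le_abs_self _).trans' (by linarith)) measureReal_nonneg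

lemma IsCompact.exists_abs_linearMap_le (hK : IsCompact K)
    (ℓ : EuclideanSpace ℝ (Fin n) →ₗ[ℝ] ℝ) : ∃ δ > 0, ∀ y ∈ K, |ℓ y| ≤ δ := by
  obtain ⟨C, hC⟩ := hK.exists_bound_of_continuousOn ℓ.continuous_of_finiteDimensional.continuousOn
  exact ⟨max C 1, by positivity, fun y hy => (hC y hy).trans (le_max_left _ _)⟩

/-- The volume of the sum of a convex body and segments is a multiaffine polynomial in the lengths
of the segments, the coefficients of low degree being positive. -/
lemma exists_pos_coeff_volume_add_zonotope [DecidableEq ι] (hK : IsCompact K) (hKc : Convex ℝ K)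
    (hv : 0 < volume.real K) {u : ι → EuclideanSpace ℝ (Fin n)}
    (hu1 : ∀ i, ∃ ℓ : EuclideanSpace ℝ (Fin n) →ₗ[ℝ] ℝ, ℓ (u i) = 1)
    (hu2 : ∀ i j, i ≠ j → ∃ ℓ : EuclideanSpace ℝ (Fin n) →ₗ[ℝ] ℝ, ℓ (u i) = 0 ∧ ℓ (u j) = 1) :
    ∃ A : Finset ι → ℝ,
      (∀ s, 0 ≤ s → volume.real (K + zonotope u s) = ∑ S, A S * ∏ i ∈ S, s i) ∧
      (∀ S, 0 ≤ A S) ∧ (∀ S, n < S.card → A S = 0) ∧ 0 < A ∅ ∧ (∀ i, 0 < A {i}) ∧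
      ∀ i j, i ≠ j → 0 < A {i, j} := by
  obtain ⟨A, hA, hnn, hn, hpos⟩ := exists_coeff_volume_add_zonotope u hK hKc
  refine ⟨A, hA, hnn, hn, hv.trans_le (hpos ∅ _ fun R _ => ?_), fun i => ?_, fun i j hij => ?_⟩
  · have : (fun i : ι => if i ∈ (∅ : Finset ι) then R else 0) = 0 := by ext; simp
    rw [this, zonotope_zero]
    simp
  · obtain ⟨ℓ, hℓ⟩ := hu1 i
    obtain ⟨δ, hδ, hb⟩ := hK.exists_abs_linearMap_le ℓ
    refine lt_of_lt_of_le (by positivity) (hpos {i} (volume.real K / (2 * δ)) fun R hR => ?_)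
    have : (fun k : ι => if k ∈ ({i} : Finset ι) then R else 0) = Pi.single i R := by
      ext; simp [Pi.single_apply]
    rw [this, zonotope_single]
    refine le_trans (le_of_eq ?_)
      (mul_volume_le_volume_add_segment hK ℓ hℓ hδ hb (zero_le_one.trans hR))
    rw [Finset.card_singleton]
    ring
  · obtain ⟨ℓ, hℓ⟩ := hu1 i
    obtain ⟨δ, hδ, hb⟩ := hK.exists_abs_linearMap_le ℓ
    obtain ⟨ℓ', hi, hj⟩ := hu2 i j hij
    obtain ⟨δ', hδ', hb'⟩ := hK.exists_abs_linearMap_le ℓ'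
    refine lt_of_lt_of_le (by positivity)
      (hpos {i, j} (volume.real K / (2 * δ) / (2 * δ')) fun R hR => ?_)
    have hR0 : 0 ≤ R := zero_le_one.trans hR
    have : (fun k : ι => if k ∈ ({i, j} : Finset ι) then R else 0) =
        Pi.single i R + Pi.single j R := by
      ext k
      by_cases hki : k = i
      · simp [hki, hij]
      · simp [Pi.single_apply, hki]
    rw [this, zonotope_add u (Pi.single_nonneg.2 hR0) (Pi.single_nonneg.2 hR0), zonotope_single,
      zonotope_single, ← add_assoc]
    refine le_trans (le_trans (le_of_eq ?_) (mul_le_mul_of_nonneg_left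
      (mul_volume_le_volume_add_segment hK ℓ hℓ hδ hb hR0) (by positivity : 0 ≤ R / (2 * δ'))))
      (mul_volume_le_volume_add_segment (hK.add (isCompact_Icc.image (by fun_prop))) ℓ' hj hδ'
        ?_ hR0)
    · rw [Finset.card_pair hij]
      ring
    · rintro _ ⟨y, hy, _, ⟨b, -, rfl⟩, rfl⟩
      simpa [hi] using hb' y hy

end

/-- The product of five coordinates, as a quintilinear form. -/
def QuintForm.coordProd {κ : Type*} (f : Fin 5 → κ) : QuintForm κ :=
  (LinearMap.proj (f 0)).smulRight ((LinearMap.proj (f 1)).smulRight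
    ((LinearMap.proj (f 2)).smulRight ((LinearMap.proj (f 3)).smulRight (LinearMap.proj (f 4)))))

lemma QuintForm.coordProd_apply {κ : Type*} (f : Fin 5 → κ) (x y z t u : κ → ℝ) :
    QuintForm.coordProd f x y z t u = x (f 0) * (y (f 1) * (z (f 2) * (t (f 3) * u (f 4)))) := by
  simp [QuintForm.coordProd]

lemma exists_word_of_card_le {ι : Type*} [DecidableEq ι] (m : ℕ) (S : Finset ι) (hS : S.card ≤ m) :
    ∃ f : Fin m → Option ι, (∀ k i, f k = some i → i ∈ S) ∧
      (∀ k l i, f k = some i → f l = some i → k = l) ∧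
      ∀ w : Option ι → ℝ, ∏ k, w (f k) = w none ^ (m - S.card) * ∏ i ∈ S, w (some i) := by
  induction m generalizing S with
  | zero =>
    obtain rfl : S = ∅ := by simpa using hS
    exact ⟨fun _ => none, by simp, by simp, by simp⟩
  | succ m ih =>
    rcases S.eq_empty_or_nonempty with rfl | ⟨a, ha⟩
    · exact ⟨fun _ => none, by simp, by simp, by simp⟩
    have hcard := Finset.card_erase_add_one ha
    obtain ⟨f, hf1, hf2, hf3⟩ := ih (S.erase a) (by omega)
    refine ⟨Fin.cons (some a) f, fun k i h => ?_, fun k l i hk hl => ?_, fun w => ?_⟩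
    · induction k using Fin.cases with
      | zero => simp only [Fin.cons_zero, Option.some.injEq] at h; exact h ▸ ha
      | succ k => exact Finset.mem_of_mem_erase (hf1 k i (by simpa using h))
    · induction k using Fin.cases with
      | zero =>
        induction l using Fin.cases with
        | zero => rfl
        | succ l =>
          simp only [Fin.cons_zero, Fin.cons_succ, Option.some.injEq] at hk hl
          exact absurd (hf1 l i hl) (by simp [hk])
      | succ k =>
        induction l using Fin.cases with
        | zero =>
          simp only [Fin.cons_zero, Fin.cons_succ, Option.some.injEq] at hk hl
          exact absurd (hf1 k i hk) (by simp [hl])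
        | succ l => exact congrArg _ (hf2 k l i (by simpa using hk) (by simpa using hl))
    · rw [Fin.prod_univ_succ]
      simp only [Fin.cons_zero, Fin.cons_succ]
      rw [hf3, ← Finset.mul_prod_erase S (fun i => w (some i)) ha,
        show m + 1 - S.card = m - (S.erase a).card by omega]
      ring

/-- The symmetric quintilinear form obtained by polarization of the homogenization of a multiaffine
polynomial. -/
lemma exists_quintForm_of_coeff {ι : Type*} [Fintype ι] [DecidableEq ι] {A : Finset ι → ℝ}
    (hA : ∀ S, 0 ≤ A S) (hA5 : ∀ S, 5 < S.card → A S = 0) :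
    ∃ V : QuintForm (Option ι),
      (∀ x y z t u, V x y z t u = V y x z t u) ∧ (∀ x y z t u, V x y z t u = V x z y t u) ∧
      (∀ x y z t u, V x y z t u = V x y t z u) ∧ (∀ x y z t u, V x y z t u = V x y z u t) ∧
      (∀ a b c d e, 0 ≤ V (Pi.single a 1) (Pi.single b 1) (Pi.single c 1) (Pi.single d 1)
        (Pi.single e 1)) ∧
      (∀ i, V (Pi.single (some i) 1) (Pi.single (some i) 1) = 0) ∧
      ∀ w, V w w w w w = ∑ S, A S * (w none ^ (5 - S.card) * ∏ i ∈ S, w (some i)) := by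
  have hw : ∀ S : Finset ι, ∃ f : Fin 5 → Option ι,
      (∀ k l i, f k = some i → f l = some i → k = l) ∧ (S.card ≤ 5 →
      ∀ w : Option ι → ℝ, ∏ k, w (f k) = w none ^ (5 - S.card) * ∏ i ∈ S, w (some i)) := by
    intro S
    by_cases hS : S.card ≤ 5
    · obtain ⟨f, -, h1, h2⟩ := exists_word_of_card_le 5 S hS
      exact ⟨f, h1, fun _ => h2⟩
    · exact ⟨fun _ => none, by simp, fun h => absurd h hS⟩
  choose f hf hprod using hw
  set V : QuintForm (Option ι) := ∑ S, ∑ σ : Equiv.Perm (Fin 5),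
    (A S / 120) • QuintForm.coordProd fun k => f S (σ k) with hVdef
  have hV : ∀ x y z t u, V x y z t u = ∑ S, ∑ σ : Equiv.Perm (Fin 5), A S / 120 *
      (x (f S (σ 0)) * (y (f S (σ 1)) * (z (f S (σ 2)) * (t (f S (σ 3)) * u (f S (σ 4)))))) := by
    intro x y z t u
    simp only [hVdef, LinearMap.sum_apply, LinearMap.smul_apply, QuintForm.coordProd_apply,
      smul_eq_mul]
  refine ⟨V, fun x y z t u => ?_, fun x y z t u => ?_, fun x y z t u => ?_, fun x y z t u => ?_,
    fun a b c d e => ?_, fun i => ?_, fun w => ?_⟩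
  · rw [hV, hV]
    refine Finset.sum_congr rfl fun S _ => ?_
    rw [← Equiv.sum_comp (Equiv.mulRight (Equiv.swap (0 : Fin 5) 1))]
    refine Finset.sum_congr rfl fun σ _ => ?_
    simp [Equiv.swap_apply_def, -mul_eq_mul_left_iff]
    ring
  · rw [hV, hV]
    refine Finset.sum_congr rfl fun S _ => ?_
    rw [← Equiv.sum_comp (Equiv.mulRight (Equiv.swap (1 : Fin 5) 2))]
    refine Finset.sum_congr rfl fun σ _ => ?_
    simp [Equiv.swap_apply_def, -mul_eq_mul_left_iff]
    ring
  · rw [hV, hV]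
    refine Finset.sum_congr rfl fun S _ => ?_
    rw [← Equiv.sum_comp (Equiv.mulRight (Equiv.swap (2 : Fin 5) 3))]
    refine Finset.sum_congr rfl fun σ _ => ?_
    simp [Equiv.swap_apply_def, -mul_eq_mul_left_iff]
    ring
  · rw [hV, hV]
    refine Finset.sum_congr rfl fun S _ => ?_
    rw [← Equiv.sum_comp (Equiv.mulRight (Equiv.swap (3 : Fin 5) 4))]
    refine Finset.sum_congr rfl fun σ _ => ?_
    simp [Equiv.swap_apply_def, -mul_eq_mul_left_iff]
    ring
  · rw [hV]
    have h1 : ∀ a b : Option ι, 0 ≤ (Pi.single a 1 : Option ι → ℝ) b := fun a b =>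
      QuintForm.IsMixed.single_nonneg a b
    exact Finset.sum_nonneg fun S _ => Finset.sum_nonneg fun σ _ =>
      mul_nonneg (div_nonneg (hA S) (by norm_num)) (mul_nonneg (h1 _ _) (mul_nonneg (h1 _ _)
        (mul_nonneg (h1 _ _) (mul_nonneg (h1 _ _) (h1 _ _)))))
  · refine LinearMap.ext fun z => LinearMap.ext fun t => LinearMap.ext fun u => ?_
    rw [hV]
    simp only [LinearMap.zero_apply]
    refine Finset.sum_eq_zero fun S _ => Finset.sum_eq_zero fun σ _ => ?_
    by_cases h0 : f S (σ 0) = some i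
    · have h1 : f S (σ 1) ≠ some i := fun h1 => by simpa using hf S _ _ i h0 h1
      simp [Pi.single_apply, h1]
    · simp [Pi.single_apply, h0]
  · rw [hV]
    refine Finset.sum_congr rfl fun S _ => ?_
    by_cases hS : S.card ≤ 5
    · have : ∀ σ : Equiv.Perm (Fin 5), A S / 120 * (w (f S (σ 0)) * (w (f S (σ 1)) *
          (w (f S (σ 2)) * (w (f S (σ 3)) * w (f S (σ 4)))))) =
          A S / 120 * (w none ^ (5 - S.card) * ∏ i ∈ S, w (some i)) := by
        intro σ
        rw [← hprod S hS w, ← Equiv.prod_comp σ, Fin.prod_univ_five]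
        ring
      rw [Finset.sum_congr rfl fun σ _ => this σ, Finset.sum_const, Finset.card_univ,
        Fintype.card_perm, Fintype.card_fin, nsmul_eq_mul,
        show Nat.factorial 5 = 120 from rfl]
      push_cast
      ring
    · simp [hA5 S (by omega)]

lemma sum_mul_prod_indicator {ι : Type*} [Fintype ι] [DecidableEq ι] (A : Finset ι → ℝ)
    (T : Finset ι) {s : ι → ℝ} (hs : ∀ i, s i = if i ∈ T then 1 else 0) :
    ∑ S, A S * ∏ i ∈ S, s i = ∑ S ∈ T.powerset, A S := by
  rw [← Finset.sum_subset (Finset.subset_univ T.powerset)]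
  · refine Finset.sum_congr rfl fun S hS => ?_
    rw [Finset.prod_eq_one fun i hi => by rw [hs, if_pos (Finset.mem_powerset.1 hS hi)], mul_one]
  · intro S _ hS
    obtain ⟨i, hi, hiT⟩ := Finset.not_subset.1 (fun h => hS (Finset.mem_powerset.2 h))
    rw [Finset.prod_eq_zero hi (by rw [hs, if_neg hiT]), mul_zero]

lemma QuintForm.apply_add_add {κ : Type*} {V : QuintForm κ}
    (h12 : ∀ x y z t u, V x y z t u = V y x z t u) (h23 : ∀ x y z t u, V x y z t u = V x z y t u)
    (h34 : ∀ x y z t u, V x y z t u = V x y t z u) (h45 : ∀ x y z t u, V x y z t u = V x y z u t)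
    {k x y : κ → ℝ} (hx : V x x = 0) (hy : V y y = 0) :
    V (k + x + y) (k + x + y) (k + x + y) (k + x + y) (k + x + y) =
      V k k k k k + 5 * V k k k k x + 5 * V k k k k y + 20 * V k k k x y := by
  have z12 : ∀ v, V v v = 0 → ∀ a b c, V v v a b c = 0 := fun v hv a b c => by simp [hv]
  have z23 : ∀ v, V v v = 0 → ∀ a b c, V a v v b c = 0 := fun v hv a b c => by
    rw [h12, h23, z12 v hv]
  have z34 : ∀ v, V v v = 0 → ∀ a b c, V a b v v c = 0 := fun v hv a b c => by
    rw [h23, h34, z23 v hv]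
  have z45 : ∀ v, V v v = 0 → ∀ a b c, V a b c v v = 0 := fun v hv a b c => by
    rw [h34, h45, z34 v hv]
  simp only [map_add, LinearMap.add_apply, h12 x k, h23 _ x k, h34 _ _ x k,
    h45 _ _ _ x k, h12 y k, h23 _ y k, h34 _ _ y k, h45 _ _ _ y k,
    h12 y x, h23 _ y x, h34 _ _ y x, h45 _ _ _ y x, z12 x hx, z12 y hy, z23 x hx, z23 y hy,
    z34 x hx, z34 y hy, z45 x hx, z45 y hy]
  ring

section

variable {n : ℕ} {ι : Type*} [Fintype ι] {K : Set (EuclideanSpace ℝ (Fin n))}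

lemma volume_smul_add_zonotope (u : ι → EuclideanSpace ℝ (Fin n)) {x : ℝ} (hx : 0 < x)
    (s : ι → ℝ) : volume.real (x • K + zonotope u s) =
      x ^ n * volume.real (K + zonotope u (x⁻¹ • s)) := by
  have : x • K + zonotope u s = x • (K + zonotope u (x⁻¹ • s)) := by
    rw [smul_add, ← zonotope_smul u hx, smul_inv_smul₀ hx.ne']
  rw [this, measureReal_def, Measure.addHaar_smul, ENNReal.toReal_mul,
    ENNReal.toReal_ofReal (abs_nonneg _), finrank_euclideanSpace_fin, abs_of_pos (by positivity)]
  rfl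

lemma volume_mul_volume_smul_add_zonotope_le (hK : IsCompact K) (hKc : Convex ℝ K)
    (u : ι → EuclideanSpace ℝ (Fin n)) {x x' : ℝ} (hx : 0 < x) (hx' : 0 < x') {s s' : ι → ℝ}
    (hs : 0 ≤ s) (hs' : 0 ≤ s') :
    volume.real (x • K + zonotope u s) * volume.real (x' • K + zonotope u s') ≤
      volume.real ((1 / 2 * (x + x')) • K + zonotope u ((1 / 2 : ℝ) • (s + s'))) ^ 2 := by
  have hc : ∀ (y : ℝ) (r : ι → ℝ), IsCompact (y • K + zonotope u r) := fun y r =>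
    (hK.smul y).add (isCompact_zonotope u r)
  have e : (1 / 2 : ℝ) • (x • K + zonotope u s + (x' • K + zonotope u s')) =
      (1 / 2 * (x + x')) • K + zonotope u ((1 / 2 : ℝ) • (s + s')) := by
    rw [zonotope_smul u one_half_pos, zonotope_add u hs hs', mul_smul,
      hKc.add_smul hx.le hx'.le, ← smul_add]
    congr 1
    abel
  have h := (hc x s).volume_mul_volume_le (hc x' s')
  rw [e] at h
  have := ENNReal.toReal_mono (ENNReal.pow_ne_top (hc _ _).measure_ne_top) h
  rwa [ENNReal.toReal_mul, ENNReal.toReal_pow] at this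

/-- The volume of the sum of a convex body and pairwise non-parallel segments in dimension at most
five is the restriction of a quintilinear form with the properties of the mixed volume. -/
lemma exists_isMixed_volume_add_zonotope [DecidableEq ι] (hn : n ≤ 5) (hK : IsCompact K)
    (hKc : Convex ℝ K) (hv : 0 < volume.real K) {u : ι → EuclideanSpace ℝ (Fin n)}
    (hu1 : ∀ i, ∃ ℓ : EuclideanSpace ℝ (Fin n) →ₗ[ℝ] ℝ, ℓ (u i) = 1)
    (hu2 : ∀ i j, i ≠ j → ∃ ℓ : EuclideanSpace ℝ (Fin n) →ₗ[ℝ] ℝ, ℓ (u i) = 0 ∧ ℓ (u j) = 1) :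
    ∃ V : QuintForm (Option ι), V.IsMixed ∧ ∀ w, 0 ≤ w → w none = 1 →
      V w w w w w = volume.real (K + zonotope u fun i => w (some i)) := by
  obtain ⟨A, hA, hnn, hcard, h0, h1, h2⟩ := exists_pos_coeff_volume_add_zonotope hK hKc hv hu1 hu2
  obtain ⟨V, h12, h23, h34, h45, hsing, hseg, hdiag⟩ :=
    exists_quintForm_of_coeff hnn fun S hS => hcard S (hn.trans_lt hS)
  have hone : ∀ w : Option ι → ℝ, w none = 1 →
      V w w w w w = ∑ S, A S * ∏ i ∈ S, w (some i) := fun w hw => by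
    simp [hdiag, hw]
  have hvol : ∀ w : Option ι → ℝ, (∀ a, 0 < w a) → V w w w w w = w none ^ (5 - n) *
      volume.real (w none • K + zonotope u fun i => w (some i)) := by
    intro w hw
    have hw0 := hw none
    rw [volume_smul_add_zonotope u hw0,
      hA (_ • _) fun i => mul_nonneg (inv_nonneg.2 hw0.le) (hw _).le,
      hdiag, ← mul_assoc, ← pow_add, Nat.sub_add_cancel hn, Finset.mul_sum]
    refine Finset.sum_congr rfl fun S _ => ?_
    by_cases hS : S.card ≤ 5
    · simp only [Pi.smul_apply, smul_eq_mul, Finset.prod_mul_distrib, Finset.prod_const]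
      rw [pow_sub₀ _ hw0.ne' hS, inv_pow]
      ring
    · rw [hcard S (by omega)]
      ring
  set k : Option ι → ℝ := Pi.single none 1 with hk
  set e : ι → Option ι → ℝ := fun i => Pi.single (some i) 1 with he
  have hk5 : V k k k k k = A ∅ := by
    rw [hone k (by simp [hk]), sum_mul_prod_indicator A ∅ (by simp [hk])]
    simp
  have hk4 : ∀ i, V k k k k (e i) = A {i} / 5 := by
    intro i
    have h := hone (k + e i + 0) (by simp [hk, he])
    rw [sum_mul_prod_indicator A {i} (by simp [hk, he, Pi.single_apply]),
      ← insert_empty_eq, Finset.sum_powerset_insert (by simp),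
      QuintForm.apply_add_add h12 h23 h34 h45 (hseg i) (by simp)] at h
    simp only [Finset.powerset_empty, Finset.sum_singleton, insert_empty_eq, map_zero, hk5] at h
    linarith
  refine ⟨V, ⟨h12, h23, h34, h45, hsing, hseg, ?_, fun i => ?_, fun i j hij => ?_,
    fun w w' hw hw' => ?_⟩, fun w hw hw1 => ?_⟩
  · rw [← hk, hk5]
    exact h0
  · rw [← hk, hk4 i]
    exact div_pos (h1 i) (by norm_num)
  · have h := hone (k + e i + e j) (by simp [hk, he])
    rw [sum_mul_prod_indicator A {i, j} (by
      intro l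
      by_cases hli : l = i
      · simp [hk, he, hli, hij]
      · simp [hk, he, hli, Pi.single_apply]),
      Finset.sum_powerset_insert (by simpa using hij), ← insert_empty_eq,
      Finset.sum_powerset_insert (by simp), Finset.sum_powerset_insert (by simp)] at h
    rw [QuintForm.apply_add_add h12 h23 h34 h45 (hseg i) (hseg j), hk5, hk4 i, hk4 j] at h
    simp only [Finset.powerset_empty, Finset.sum_singleton, insert_empty_eq] at h
    have hpos := h2 i j hij
    change 0 < V k k k (e i) (e j)
    linarith
  · rw [hvol w hw, hvol w' hw', hvol _ fun a => by
      have := hw a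
      have := hw' a
      simp only [Pi.smul_apply, Pi.add_apply, smul_eq_mul]
      linarith]
    have hBM := volume_mul_volume_smul_add_zonotope_le hK hKc u (hw none) (hw' none)
      (s := fun i => w (some i)) (s' := fun i => w' (some i))
      (fun i => (hw _).le) (fun i => (hw' _).le)
    have hx : w none * w' none ≤ (1 / 2 * (w none + w' none)) ^ 2 := by
      nlinarith [sq_nonneg (w none - w' none)]
    have hx0 : 0 ≤ w none * w' none := (mul_pos (hw none) (hw' none)).le
    calc _ = (w none * w' none) ^ (5 - n) *
          (volume.real (w none • K + zonotope u fun i => w (some i)) *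
            volume.real (w' none • K + zonotope u fun i => w' (some i))) := by
          rw [mul_pow]; ring
      _ ≤ _ := mul_le_mul (pow_le_pow_left₀ hx0 hx _) hBM
          (mul_nonneg measureReal_nonneg measureReal_nonneg) (by positivity)
      _ = _ := by rw [← pow_mul, mul_comm 2, pow_mul, ← mul_pow]; rfl
  · rw [hone w hw1, hA _ fun i => hw _]

end

lemma mul_le_mul_of_logConcave {a₀ a₁ a₂ a₃ a₄ a₅ : ℝ} (h₀ : 0 ≤ a₀) (h₁ : 0 < a₁) (h₂ : 0 < a₂)
    (h₃ : 0 < a₃) (h₄ : 0 < a₄) (h₀₂ : a₀ * a₂ ≤ a₁ ^ 2) (h₁₃ : a₁ * a₃ ≤ a₂ ^ 2)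
    (h₂₄ : a₂ * a₄ ≤ a₃ ^ 2)
    (h₃₅ : a₃ * a₅ ≤ a₄ ^ 2) :
    a₀ * a₃ ≤ a₁ * a₂ ∧ a₀ * a₄ ≤ a₁ * a₃ ∧ a₀ * a₅ ≤ a₁ * a₄ ∧ a₁ * a₄ ≤ a₂ * a₃ := by
  have e₂ : a₀ ≤ a₁ * (a₁ / a₂) := by rw [← mul_div_assoc, le_div_iff₀ h₂]; linarith
  have e₃ : a₁ / a₂ ≤ a₂ / a₃ := by rw [div_le_div_iff₀ h₂ h₃]; linarith
  have e₄ : a₂ / a₃ ≤ a₃ / a₄ := by rw [div_le_div_iff₀ h₃ h₄]; linarith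
  have e₅ : a₃ / a₄ * a₅ ≤ a₄ := by rw [div_mul_eq_mul_div, div_le_iff₀ h₄]; linarith
  have f₃ : a₀ ≤ a₁ * (a₂ / a₃) := e₂.trans (by gcongr)
  have f₄ : a₀ ≤ a₁ * (a₃ / a₄) := f₃.trans (by gcongr)
  refine ⟨?_, ?_, ?_, ?_⟩
  · rwa [← mul_div_assoc, le_div_iff₀ h₃] at f₃
  · rwa [← mul_div_assoc, le_div_iff₀ h₄] at f₄
  · rcases le_or_gt a₅ 0 with h | h
    · exact (mul_nonpos_of_nonneg_of_nonpos h₀ h).trans (by positivity)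
    · calc a₀ * a₅ ≤ a₁ * (a₃ / a₄) * a₅ := by gcongr
        _ = a₁ * (a₃ / a₄ * a₅) := by ring
        _ ≤ a₁ * a₄ := by gcongr
  · have := e₃.trans e₄
    rw [div_le_div_iff₀ h₂ h₄] at this
    linarith

namespace QuintForm.IsMixed

variable {ι : Type*} [DecidableEq ι] [Fintype ι] {V : QuintForm (Option ι)}

/-- Consequences of the Aleksandrov-Fenchel inequalities that are not affected by vanishing
mixed volumes. -/
lemma mul_le_mul_sequence (hV : V.IsMixed) {c : Option ι → ℝ} (hc0 : 0 ≤ c)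
    (hc : ∀ i, 0 < c (some i)) {k : Option ι → ℝ} (hk : k = Pi.single none 1) :
    V k k k k k * V k k c c c ≤ V k k k k c * V k k k c c ∧
    V k k k k k * V k c c c c ≤ V k k k k c * V k k c c c ∧
    V k k k k k * V c c c c c ≤ V k k k k c * V k c c c c ∧
    V k k k k c * V k c c c c ≤ V k k k c c * V k k c c c := by
  have hk0 : 0 ≤ k := hk ▸ single_nonneg none
  have key : ∀ t : ℝ, 0 < t → t < 1 → _ := fun t ht _ => by
    have hw0 : 0 ≤ c + t • k := add_nonneg hc0 (smul_nonneg ht.le hk0)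
    have hwn : 0 < (c + t • k) none := by
      have := hc0 none
      simp only [Pi.add_apply, Pi.smul_apply, smul_eq_mul, hk, Pi.single_eq_same,
        Pi.zero_apply] at this ⊢
      linarith
    obtain ⟨h02, h13, h24, h35⟩ :=
      hV.log_concave_sequence hw0 (fun i => by simpa [hk] using hc i) hk
    have p0 : 0 < V k k k k k := hk ▸ hV.pos_body
    have p1 : 0 < V k k k k (c + t • k) := by
      rw [hV.swap45, hV.swap34, hV.swap23, hV.swap12]
      refine hV.pos_of_pos_body hw0 hwn hk0 hk0 hk0 hk0 ?_
      rwa [← hk]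
    have p2 : 0 < V k k k (c + t • k) (c + t • k) := by
      rw [hV.swap34, hV.swap23, hV.swap12]
      refine hV.pos_of_pos_body hw0 hwn hk0 hk0 hk0 hw0 ?_
      rwa [← hk]
    have p3 : 0 < V k k (c + t • k) (c + t • k) (c + t • k) := by
      rw [hV.swap23, hV.swap12]
      refine hV.pos_of_pos_body hw0 hwn hk0 hk0 hw0 hw0 ?_
      rwa [← hk]
    have p4 : 0 < V k (c + t • k) (c + t • k) (c + t • k) (c + t • k) := by
      rw [hV.swap12]
      refine hV.pos_of_pos_body hw0 hwn hk0 hw0 hw0 hw0 ?_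
      rwa [← hk]
    exact mul_le_mul_of_logConcave p0.le p1 p2 p3 p4 h02 h13 h24 h35
  simp only [map_add, map_smul, LinearMap.add_apply, LinearMap.smul_apply, smul_eq_mul] at key
  refine ⟨?_, ?_, ?_, ?_⟩
  · have := nonpos_at_zero_of_small (by fun_prop) one_pos
      fun t h0 h1 => sub_nonpos.2 (key t h0 h1).1
    simpa using this
  · have := nonpos_at_zero_of_small (by fun_prop) one_pos
      fun t h0 h1 => sub_nonpos.2 (key t h0 h1).2.1
    simpa using this
  · have := nonpos_at_zero_of_small (by fun_prop) one_pos
      fun t h0 h1 => sub_nonpos.2 (key t h0 h1).2.2.1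
    simpa using this
  · have := nonpos_at_zero_of_small (by fun_prop) one_pos
      fun t h0 h1 => sub_nonpos.2 (key t h0 h1).2.2.2
    simpa using this

end QuintForm.IsMixed

section

variable {n : ℕ}

lemma setIntegral_closedBall_abs_inner_eq {x y : EuclideanSpace ℝ (Fin n)} (h : ‖x‖ = ‖y‖) :
    ∫ v in closedBall 0 1, |inner ℝ v x| = ∫ v in closedBall 0 1, |inner ℝ v y| := by
  set ρ := Submodule.reflection (Submodule.span ℝ {x - y})ᗮ
  have hρ : ρ x = y := Submodule.reflection_sub h
  have := ρ.measurePreserving.setIntegral_preimage_emb ρ.toHomeomorph.measurableEmbedding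
    (fun v => |inner ℝ v y|) (closedBall 0 1)
  rw [← this, ρ.preimage_closedBall, map_zero]
  simp only [← hρ, LinearIsometryEquiv.inner_map_map]

lemma setIntegral_closedBall_abs_inner_pos {x : EuclideanSpace ℝ (Fin n)} (hx : ‖x‖ = 1) :
    0 < ∫ v in closedBall 0 1, |inner ℝ v x| := by
  rw [setIntegral_pos_iff_support_of_nonneg_ae (Filter.Eventually.of_forall fun v => abs_nonneg _)
    ((Continuous.continuousOn (by fun_prop)).integrableOn_compact
      (isCompact_closedBall 0 1))]
  refine lt_of_lt_of_le ?_ (measure_mono (s := ball ((1 / 2 : ℝ) • x) (1 / 2)) fun v hv => ?_)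
  · exact measure_ball_pos _ _ (by norm_num)
  · rw [mem_ball_iff_norm] at hv
    have h1 : v = (v - (1 / 2 : ℝ) • x) + (1 / 2 : ℝ) • x := by abel
    have hx2 : ‖(1 / 2 : ℝ) • x‖ = 1 / 2 := by rw [norm_smul, hx]; norm_num
    refine ⟨?_, ?_⟩
    · rw [Function.mem_support]
      have h2 : inner ℝ v x = inner ℝ (v - (1 / 2 : ℝ) • x) x + 1 / 2 := by
        rw [inner_sub_left, real_inner_smul_left, real_inner_self_eq_norm_sq, hx]; ring
      have h3 := abs_le.1 (abs_real_inner_le_norm (v - (1 / 2 : ℝ) • x) x)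
      rw [hx, mul_one] at h3
      rw [h2]
      exact (abs_pos.2 (by linarith [h3.1])).ne'
    · rw [mem_closedBall_zero_iff, h1]
      refine (norm_add_le _ _).trans ?_
      linarith

/-- The Euclidean norm is a limit of sums of absolute values of linear functionals, which may be
taken from a given affine hyperplane not containing the origin. -/
lemma exists_sum_abs_inner_near_norm {e : EuclideanSpace ℝ (Fin n)} (he : e ≠ 0) {ε : ℝ}
    (hε : 0 < ε) :
    ∃ (ι : Type) (_ : Fintype ι) (u : ι → EuclideanSpace ℝ (Fin n)) (c : ι → ℝ),
      Function.Injective u ∧ (∀ i, inner ℝ e (u i) = 1) ∧ (∀ i, 0 < c i) ∧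
      ∀ x, |∑ i, c i * |inner ℝ (u i) x| - ‖x‖| ≤ ε * ‖x‖ := by
  set X := sphere (0 : EuclideanSpace ℝ (Fin n)) 1
  set f : EuclideanSpace ℝ (Fin n) → C(X, ℝ) := fun v => ⟨fun x => |inner ℝ v x|, by fun_prop⟩
    with hfdef
  have hf : Continuous f := ContinuousMap.continuous_of_continuous_uncurry _ (by
    simp only [hfdef, Function.uncurry_def, ContinuousMap.coe_mk]
    fun_prop)
  set D := PointedCone.hull ℝ (f '' {u | inner ℝ e u = 1})
  set C := D.closure
  have hC : IsClosed (C : Set C(X, ℝ)) := isClosed_closure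
  have h1 : ∀ v, inner ℝ e v ≠ 0 → f v ∈ C := by
    intro v hv
    have : f v = |inner ℝ e v| • f ((inner ℝ e v)⁻¹ • v) := by
      ext x
      simp only [hfdef, ContinuousMap.coe_mk, ContinuousMap.smul_apply, smul_eq_mul,
        real_inner_smul_left, abs_mul, abs_inv]
      rw [mul_inv_cancel_left₀ (abs_ne_zero.2 hv)]
    rw [this]
    refine C.smul_mem (abs_nonneg _) (subset_closure (PointedCone.subset_hull ⟨_, ?_, rfl⟩))
    simp [real_inner_smul_right, hv]
  have h2 : ∀ v, f v ∈ C := by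
    intro v
    by_cases hv : inner ℝ e v = 0
    · have hcont : Continuous fun t : ℝ => f (v + t • e) := hf.comp (by fun_prop)
      have hlim := (hcont.tendsto 0).mono_left (nhdsWithin_le_nhds (s := {0}ᶜ))
      simp only [zero_smul, add_zero] at hlim
      refine hC.mem_of_tendsto hlim ?_
      filter_upwards [self_mem_nhdsWithin] with t ht
      refine h1 _ ?_
      rw [inner_add_right, hv, zero_add, real_inner_smul_right]
      exact mul_ne_zero ht (inner_self_ne_zero.2 he)
    · exact h1 v hv
  have hint : IntegrableOn f (closedBall 0 1) :=
    hf.continuousOn.integrableOn_compact (isCompact_closedBall 0 1)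
  have h3 : ⨍ v in closedBall 0 1, f v ∈ C :=
    C.convex.set_average_mem hC (measure_closedBall_pos _ _ one_pos).ne'
      (isCompact_closedBall _ _).measure_ne_top (Filter.Eventually.of_forall h2) hint
  set x₀ := ‖e‖⁻¹ • e
  have hx₀ : ‖x₀‖ = 1 := norm_smul_inv_norm he
  set r := (volume.real (closedBall (0 : EuclideanSpace ℝ (Fin n)) 1))⁻¹ *
    ∫ v in closedBall 0 1, |inner ℝ v x₀|
  have hr : 0 < r := mul_pos (inv_pos.2 (ENNReal.toReal_pos
    (measure_closedBall_pos _ _ one_pos).ne' (isCompact_closedBall _ _).measure_ne_top))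
    (setIntegral_closedBall_abs_inner_pos hx₀)
  have h4 : (1 : C(X, ℝ)) ∈ C := by
    have : (1 : C(X, ℝ)) = r⁻¹ • ⨍ v in closedBall 0 1, f v := by
      ext x
      have hx : ‖(x : EuclideanSpace ℝ (Fin n))‖ = ‖x₀‖ := by simp [hx₀]
      rw [setAverage_eq, ContinuousMap.smul_apply, ContinuousMap.smul_apply,
        ContinuousMap.integral_apply hint]
      simp only [hfdef, ContinuousMap.coe_mk, smul_eq_mul, ContinuousMap.one_apply]
      rw [setIntegral_closedBall_abs_inner_eq hx]
      exact (inv_mul_cancel₀ hr.ne').symm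
    rw [this]
    exact C.smul_mem (inv_nonneg.2 hr.le) h3
  obtain ⟨g, hg, hg1⟩ := Metric.mem_closure_iff.1 h4 ε hε
  obtain ⟨c, hcs, hc0, hcg⟩ := PointedCone.mem_hull_set.1 hg
  choose u hu huf using fun i : c.support => hcs i.2
  refine ⟨c.support, inferInstance, u, fun i => c i, fun i j hij => ?_, hu, fun i => ?_,
    fun x => ?_⟩
  · exact Subtype.ext (by rw [← huf i, ← huf j, hij])
  · exact lt_of_le_of_ne (hc0 _) (Finsupp.mem_support_iff.1 i.2).symm
  · by_cases hx : x = 0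
    · simp [hx]
    have hxn : 0 < ‖x‖ := norm_pos_iff.2 hx
    set y : X := ⟨‖x‖⁻¹ • x, mem_sphere_zero_iff_norm.2 (norm_smul_inv_norm (𝕜 := ℝ) hx)⟩
    have hgy : g y = ∑ i : c.support, c i * |inner ℝ (u i) (‖x‖⁻¹ • x)| := by
      rw [← hcg, Finsupp.sum, ContinuousMap.sum_apply, ← Finset.sum_coe_sort]
      refine Finset.sum_congr rfl fun i _ => ?_
      rw [← huf i]
      rfl
    have hd := (ContinuousMap.dist_apply_le_dist (f := 1) (g := g) y).trans hg1.le
    rw [dist_comm, Real.dist_eq, hgy, ContinuousMap.one_apply] at hd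
    have : ∑ i : c.support, c i * |inner ℝ (u i) x| - ‖x‖ =
        ‖x‖ * (∑ i : c.support, c i * |inner ℝ (u i) (‖x‖⁻¹ • x)| - 1) := by
      rw [mul_sub, Finset.mul_sum, mul_one]
      congr 1
      refine Finset.sum_congr rfl fun i _ => ?_
      rw [real_inner_smul_right, abs_mul, abs_inv, abs_norm]
      field_simp
    rw [this, abs_mul, abs_norm, mul_comm]
    exact mul_le_mul_of_nonneg_right hd hxn.le

end

section

variable {n : ℕ}

/-- Zonotopes approximate the ball. -/
lemma exists_zonotope_near_closedBall {e : EuclideanSpace ℝ (Fin n)} (he : e ≠ 0) {ε : ℝ}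
    (hε : 0 < ε) :
    ∃ (ι : Type) (_ : Fintype ι) (u : ι → EuclideanSpace ℝ (Fin n)) (c : ι → ℝ)
      (p : EuclideanSpace ℝ (Fin n)), Function.Injective u ∧ (∀ i, inner ℝ e (u i) = 1) ∧
      (∀ i, 0 < c i) ∧ closedBall 0 (1 - ε) ⊆ p +ᵥ zonotope u c ∧
      p +ᵥ zonotope u c ⊆ closedBall 0 (1 + ε) := by
  obtain ⟨ι, _, u, c, hu, hu1, hc, hx⟩ := exists_sum_abs_inner_near_norm he hε
  have hc2 : ∀ a : ι → ℝ, ∑ i, (a i - c i) • u i = -∑ i, c i • u i + ∑ i, a i • u i := fun a => by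
    simp only [sub_smul, Finset.sum_sub_distrib]
    abel
  refine ⟨ι, inferInstance, u, (2 : ℝ) • c, -∑ i, c i • u i, hu, hu1,
    fun i => mul_pos two_pos (hc i), fun y hy => ?_, ?_⟩
  · by_contra hyZ
    obtain ⟨f, r, hf, hr⟩ := geometric_hahn_banach_closed_point
      ((convex_zonotope u _).vadd _) ((isCompact_zonotope u _).vadd _).isClosed hyZ
    set x := (InnerProductSpace.toDual ℝ (EuclideanSpace ℝ (Fin n))).symm f
    have hfx : ∀ v, f v = inner ℝ x v := fun v =>
      (InnerProductSpace.toDual_symm_apply (𝕜 := ℝ)).symm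
    set a : ι → ℝ := fun i => c i + c i * SignType.sign (inner ℝ (u i) x)
    have hsign : ∀ b : ℝ, -1 ≤ (SignType.sign b : ℝ) ∧ (SignType.sign b : ℝ) ≤ 1 := fun b => by
      rcases lt_trichotomy b 0 with h | h | h <;> simp [h]
    have ha : a ∈ Set.Icc 0 ((2 : ℝ) • c) := by
      refine ⟨fun i => ?_, fun i => ?_⟩
      · have := (hsign (inner ℝ (u i) x)).1
        have := hc i
        simp only [a, Pi.zero_apply]
        nlinarith
      · have := (hsign (inner ℝ (u i) x)).2
        have := hc i
        simp only [a, Pi.smul_apply, smul_eq_mul]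
        nlinarith
    have h1 := hf _ (Set.vadd_mem_vadd_set (a := -∑ i, c i • u i) ⟨a, ha, rfl⟩)
    rw [vadd_eq_add, ← hc2, hfx, inner_sum] at h1
    have h2 : ∑ i, inner ℝ x ((a i - c i) • u i) = ∑ i, c i * |inner ℝ (u i) x| := by
      refine Finset.sum_congr rfl fun i _ => ?_
      simp only [a, add_sub_cancel_left]
      rw [real_inner_smul_right, mul_assoc, real_inner_comm, sign_mul_self]
    rw [h2] at h1
    rw [hfx] at hr
    have h3 := real_inner_le_norm x y
    have h4 := (abs_le.1 (hx x)).1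
    rw [mem_closedBall_zero_iff] at hy
    have h5 := mul_le_mul_of_nonneg_left hy (norm_nonneg x)
    linarith
  · rintro _ ⟨_, ⟨a, ha, rfl⟩, rfl⟩
    simp only [vadd_eq_add]
    rw [← hc2, mem_closedBall_zero_iff]
    set y := ∑ i, (a i - c i) • u i
    have h1 : ‖y‖ * ‖y‖ ≤ (1 + ε) * ‖y‖ := by
      have h2 : ‖y‖ * ‖y‖ = ∑ i, (a i - c i) * inner ℝ (u i) y := by
        rw [← real_inner_self_eq_norm_mul_norm]
        conv_lhs => rw [show y = ∑ i, (a i - c i) • u i from rfl, sum_inner]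
        exact Finset.sum_congr rfl fun i _ => real_inner_smul_left _ _ _
      have h3 : ∑ i, (a i - c i) * inner ℝ (u i) y ≤ ∑ i, c i * |inner ℝ (u i) y| := by
        refine Finset.sum_le_sum fun i _ => (le_abs_self _).trans ?_
        rw [abs_mul]
        refine mul_le_mul_of_nonneg_right (abs_le.2 ?_) (abs_nonneg _)
        have h4 := ha.1 i
        have h5 := ha.2 i
        simp only [Pi.zero_apply, Pi.smul_apply, smul_eq_mul] at h4 h5
        constructor <;> linarith
      have h4 := (abs_le.1 (hx y)).2
      linarith
    rcases eq_or_ne y 0 with h | h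
    · rw [h, norm_zero]; linarith
    · exact le_of_mul_le_mul_right h1 (norm_pos_iff.2 h)

/-- The inequalities for the (normalized) coefficients of the Steiner polynomial in dimension at
most five. -/
structure IsAleksandrovFenchel (W : ℕ → ℝ) : Prop where
  nonneg : ∀ k ≤ 5, 0 ≤ W k
  log_concave : ∀ k ≤ 3, W k * W (k + 2) ≤ W (k + 1) ^ 2
  mul_three : W 0 * W 3 ≤ W 1 * W 2
  mul_four : W 0 * W 4 ≤ W 1 * W 3
  mul_five : W 0 * W 5 ≤ W 1 * W 4
  mul_one_four : W 1 * W 4 ≤ W 2 * W 3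

lemma IsAleksandrovFenchel.of_tendsto {W : ℕ → ℕ → ℝ} {L : ℕ → ℝ}
    (hW : ∀ m, IsAleksandrovFenchel (W m))
    (h : ∀ k ≤ 5, Filter.Tendsto (fun m => W m k) Filter.atTop (nhds (L k))) :
    IsAleksandrovFenchel L where
  nonneg k hk := ge_of_tendsto' (h k hk) fun m => (hW m).nonneg k hk
  log_concave k hk := le_of_tendsto_of_tendsto'
    ((h k (by omega)).mul (h (k + 2) (by omega))) ((h (k + 1) (by omega)).pow 2)
    fun m => (hW m).log_concave k hk
  mul_three := le_of_tendsto_of_tendsto' ((h 0 (by omega)).mul (h 3 (by omega)))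
    ((h 1 (by omega)).mul (h 2 (by omega))) fun m => (hW m).mul_three
  mul_four := le_of_tendsto_of_tendsto' ((h 0 (by omega)).mul (h 4 (by omega)))
    ((h 1 (by omega)).mul (h 3 (by omega))) fun m => (hW m).mul_four
  mul_five := le_of_tendsto_of_tendsto' ((h 0 (by omega)).mul (h 5 (by omega)))
    ((h 1 (by omega)).mul (h 4 (by omega))) fun m => (hW m).mul_five
  mul_one_four := le_of_tendsto_of_tendsto' ((h 1 (by omega)).mul (h 4 (by omega)))
    ((h 2 (by omega)).mul (h 3 (by omega))) fun m => (hW m).mul_one_four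

/-- The quintic polynomial with normalized coefficients `W`. -/
def normalizedQuintic (W : ℕ → ℝ) (t : ℝ) : ℝ :=
  W 0 + 5 * W 1 * t + 10 * W 2 * t ^ 2 + 10 * W 3 * t ^ 3 + 5 * W 4 * t ^ 4 + W 5 * t ^ 5

lemma exists_isAleksandrovFenchel_zonotope {ι : Type*} [Fintype ι] (hn : n ≤ 5)
    {K : Set (EuclideanSpace ℝ (Fin n))} (hK : IsCompact K) (hKc : Convex ℝ K)
    (hv : 0 < volume.real K) {e : EuclideanSpace ℝ (Fin n)} {u : ι → EuclideanSpace ℝ (Fin n)}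
    (hinj : Function.Injective u) (hu : ∀ i, inner ℝ e (u i) = 1) {c : ι → ℝ} (hc : ∀ i, 0 < c i) :
    ∃ W, IsAleksandrovFenchel W ∧ ∀ t : ℝ, 0 < t →
      volume.real (K + t • zonotope u c) = normalizedQuintic W t := by
  classical
  have hu2 : ∀ i j, i ≠ j →
      ∃ ℓ : EuclideanSpace ℝ (Fin n) →ₗ[ℝ] ℝ, ℓ (u i) = 0 ∧ ℓ (u j) = 1 := by
    intro i j hij
    have hd : inner ℝ (u j - u i) (u j - u i) ≠ 0 := fun h =>
      hij (hinj (sub_eq_zero.1 (inner_self_eq_zero.1 h)).symm)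
    refine ⟨(inner ℝ (u j - u i) (u j - u i))⁻¹ • ((innerₛₗ ℝ (u j - u i)) -
      inner ℝ (u j - u i) (u i) • (innerₛₗ ℝ e)), ?_, ?_⟩
    · simp only [LinearMap.smul_apply, LinearMap.sub_apply, innerₛₗ_apply_apply, hu, smul_eq_mul,
        mul_one, sub_self, mul_zero]
    · simp only [LinearMap.smul_apply, LinearMap.sub_apply, innerₛₗ_apply_apply, hu, smul_eq_mul,
        mul_one]
      rw [← inner_sub_right]
      exact inv_mul_cancel₀ hd
  obtain ⟨V, hV, hVvol⟩ := exists_isMixed_volume_add_zonotope hn hK hKc hv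
    (fun i => ⟨innerₛₗ ℝ e, hu i⟩) hu2
  set k : Option ι → ℝ := Pi.single none 1 with hk
  set b : Option ι → ℝ := fun a => a.elim 0 c with hb
  have hk0 : 0 ≤ k := QuintForm.IsMixed.single_nonneg none
  have hb0 : 0 ≤ b := fun a => by
    cases a with
    | none => exact le_rfl
    | some i => exact (hc i).le
  obtain ⟨h02, h13, h24, h35⟩ := hV.log_concave_sequence hb0 (fun i => hc i) hk
  obtain ⟨h03, h04, h05, h14⟩ := hV.mul_le_mul_sequence hb0 (fun i => hc i) hk
  refine ⟨fun j => match j with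
    | 0 => V k k k k k
    | 1 => V k k k k b
    | 2 => V k k k b b
    | 3 => V k k b b b
    | 4 => V k b b b b
    | _ => V b b b b b, ⟨fun j hj => ?_, fun j hj => ?_, h03, h04, h05, h14⟩, fun t ht => ?_⟩
  · interval_cases j <;> apply hV.nonneg <;> assumption
  · interval_cases j
    exacts [h02, h13, h24, h35]
  · have h := hVvol (k + t • b) (add_nonneg hk0 (smul_nonneg ht.le hb0)) (by simp [hk, hb])
    rw [hV.apply_self_add_smul] at h
    have e1 : (fun i => (k + t • b) (some i)) = t • c := by
      ext i
      simp [hk, hb]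
    rw [e1, zonotope_smul u ht] at h
    rw [← h]
    simp only [normalizedQuintic]
    ring

end

lemma IsAleksandrovFenchel.pos {W : ℕ → ℝ} (hW : IsAleksandrovFenchel W) {n : ℕ} (hn1 : 1 ≤ n)
    (hn5 : n ≤ 5) (h0 : 0 < W 0) (hn : 0 < W n) : ∀ k ≤ n, 0 < W k := by
  have of_mul : ∀ {i j : ℕ}, i ≤ 5 → j ≤ 5 → 0 < W i * W j → 0 < W i ∧ 0 < W j :=
    fun hi hj h => ⟨pos_of_mul_pos_left h (hW.nonneg _ hj), pos_of_mul_pos_right h (hW.nonneg _ hi)⟩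
  have hmul := mul_pos h0 hn
  have h02 := hW.log_concave 0 (by norm_num)
  have h13 := hW.log_concave 1 (by norm_num)
  intro k hk
  interval_cases n
  · interval_cases k <;> assumption
  · have h1 := of_mul (i := 1) (j := 1) (by norm_num) (by norm_num) (by linarith)
    interval_cases k
    exacts [h0, h1.1, hn]
  · obtain ⟨h1, h2⟩ := of_mul (by norm_num) (by norm_num) (hmul.trans_le hW.mul_three)
    interval_cases k <;> assumption
  · have h := hmul.trans_le hW.mul_four
    obtain ⟨h1, h3⟩ := of_mul (by norm_num) (by norm_num) h
    have h2 := of_mul (i := 2) (j := 2) (by norm_num) (by norm_num) (by linarith)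
    interval_cases k
    exacts [h0, h1, h2.1, h3, hn]
  · have h := hmul.trans_le hW.mul_five
    obtain ⟨h1, h4⟩ := of_mul (by norm_num) (by norm_num) h
    obtain ⟨h2, h3⟩ := of_mul (by norm_num) (by norm_num) (h.trans_le hW.mul_one_four)
    interval_cases k <;> assumption

/-- Lagrange interpolation: the coefficients of a quintic are linear combinations of its values. -/
lemma exists_coeff_eq_sum_normalizedQuintic {k : ℕ} (hk : k ≤ 5) :
    ∃ l : ℕ → ℝ, ∀ W, W k = ∑ j ∈ Finset.range 6, l j * normalizedQuintic W (j + 1) := by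
  interval_cases k
  · refine ⟨fun j => [6, -15, 20, -15, 6, -1].getD j 0, fun W => ?_⟩
    simp [Finset.sum_range_succ, normalizedQuintic]
    ring
  · refine ⟨fun j => [-87/50, 117/20, -127/15, 33/5, -27/10, 137/300].getD j 0, fun W => ?_⟩
    simp [Finset.sum_range_succ, normalizedQuintic]
    ring
  · refine ⟨fun j => [29/60, -461/240, 31/10, -307/120, 13/12, -3/16].getD j 0, fun W => ?_⟩
    simp [Finset.sum_range_succ, normalizedQuintic]
    ring
  · refine ⟨fun j => [-31/240, 137/240, -121/120, 107/120, -19/48, 17/240].getD j 0, fun W => ?_⟩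
    simp [Finset.sum_range_succ, normalizedQuintic]
    ring
  · refine ⟨fun j => [1/30, -19/120, 3/10, -17/60, 2/15, -1/40].getD j 0, fun W => ?_⟩
    simp [Finset.sum_range_succ, normalizedQuintic]
    ring
  · refine ⟨fun j => [-1/120, 1/24, -1/12, 1/12, -1/24, 1/120].getD j 0, fun W => ?_⟩
    simp [Finset.sum_range_succ, normalizedQuintic]
    ring

lemma tendsto_coeff_of_tendsto_normalizedQuintic {W : ℕ → ℕ → ℝ} {L : ℕ → ℝ}
    (h : ∀ t : ℝ, 0 < t → Filter.Tendsto (fun m => normalizedQuintic (W m) t) Filter.atTop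
      (nhds (normalizedQuintic L t))) {k : ℕ} (hk : k ≤ 5) :
    Filter.Tendsto (fun m => W m k) Filter.atTop (nhds (L k)) := by
  obtain ⟨l, hl⟩ := exists_coeff_eq_sum_normalizedQuintic hk
  rw [hl L]
  simp only [hl (W _)]
  exact tendsto_finsetSum _ fun j _ => (h _ (by positivity)).const_mul _

section

variable {n : ℕ} {K : Set (EuclideanSpace ℝ (Fin n))}

lemma volume_add_smul_vadd (K Z : Set (EuclideanSpace ℝ (Fin n))) (p : EuclideanSpace ℝ (Fin n))
    (t : ℝ) : volume.real (K + t • (p +ᵥ Z)) = volume.real (K + t • Z) := by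
  have : K + t • (p +ᵥ Z) = (t • p) +ᵥ (K + t • Z) := by
    rw [← Set.singleton_vadd, ← Set.singleton_vadd, vadd_eq_add, vadd_eq_add, smul_add,
      Set.smul_set_singleton, add_left_comm]
  rw [this, measureReal_def, measureReal_def, measure_vadd]

lemma isAleksandrovFenchel_of_volume_eq (hn1 : 1 ≤ n) (hn5 : n ≤ 5) (hK : IsCompact K)
    (hKc : Convex ℝ K) (hv : 0 < volume.real K) {L : ℕ → ℝ} (hL : ∀ t : ℝ, 0 ≤ t →
      normalizedQuintic L t = volume.real (K + t • closedBall (0 : EuclideanSpace ℝ (Fin n)) 1)) :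
    IsAleksandrovFenchel L := by
  have : Nonempty (Fin n) := ⟨⟨0, hn1⟩⟩
  obtain ⟨e, he⟩ := exists_ne (0 : EuclideanSpace ℝ (Fin n))
  have happrox : ∀ m : ℕ, ∃ W, IsAleksandrovFenchel W ∧ ∀ t : ℝ, 0 < t →
      normalizedQuintic L (t * (1 - 1 / (m + 1))) ≤ normalizedQuintic W t ∧
      normalizedQuintic W t ≤ normalizedQuintic L (t * (1 + 1 / (m + 1))) := by
    intro m
    have hε : (0 : ℝ) < 1 / (m + 1) := by positivity
    have hε1 : (0 : ℝ) ≤ 1 - 1 / (m + 1) := by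
      rw [sub_nonneg, div_le_one (by positivity)]
      linarith [(Nat.cast_nonneg m : (0 : ℝ) ≤ m)]
    obtain ⟨ι, _, u, c, p, hinj, hu, hc, hlow, hup⟩ := exists_zonotope_near_closedBall he hε
    obtain ⟨W, hW, hWv⟩ := exists_isAleksandrovFenchel_zonotope hn5 hK hKc hv hinj hu hc
    have hball : ∀ t r : ℝ, 0 ≤ r → (t * r) • closedBall (0 : EuclideanSpace ℝ (Fin n)) 1 =
        t • closedBall 0 r := fun t r hr => by rw [mul_smul, smul_unitClosedBall_of_nonneg hr]
    refine ⟨W, hW, fun t ht => ?_⟩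
    rw [hL _ (by positivity), hL _ (by positivity), ← hWv t ht,
      ← volume_add_smul_vadd K (zonotope u c) p t, hball _ _ hε1, hball _ _ (by positivity)]
    exact ⟨measureReal_mono (Set.add_subset_add_left (Set.smul_set_mono hlow))
        (hK.add (((isCompact_zonotope u c).vadd p).smul t)).measure_ne_top,
      measureReal_mono (Set.add_subset_add_left (Set.smul_set_mono hup))
        (hK.add ((isCompact_closedBall _ _).smul t)).measure_ne_top⟩
  choose W hW hWt using happrox
  have hcont : Continuous (normalizedQuintic L) := by
    unfold normalizedQuintic
    fun_prop
  refine IsAleksandrovFenchel.of_tendsto hW fun k hk =>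
    tendsto_coeff_of_tendsto_normalizedQuintic (fun t ht => ?_) hk
  have hlim := tendsto_one_div_add_atTop_nhds_zero_nat (𝕜 := ℝ)
  refine tendsto_of_tendsto_of_tendsto_of_le_of_le ?_ ?_ (fun m => (hWt m t ht).1)
    (fun m => (hWt m t ht).2)
  · refine (hcont.tendsto t).comp ?_
    simpa using (hlim.const_sub 1).const_mul t
  · refine (hcont.tendsto t).comp ?_
    simpa using (hlim.const_add 1).const_mul t

/-- The coefficient of degree `n` of the Steiner polynomial does not vanish. -/
lemma coeff_ne_zero_of_eval_eq_volume (hKne : K.Nonempty) (hK : IsCompact K)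
    {P : Polynomial ℝ} (hPdeg : P.natDegree ≤ n) (hP : ∀ t : ℝ, 0 ≤ t →
      P.eval t = volume.real (K + t • closedBall (0 : EuclideanSpace ℝ (Fin n)) 1)) :
    P.coeff n ≠ 0 := by
  intro h0
  have hdeg : P.degree < (Polynomial.X ^ n : Polynomial ℝ).degree := by
    rw [Polynomial.degree_X_pow]
    refine lt_of_le_of_ne (Polynomial.degree_le_of_natDegree_le hPdeg) fun h => ?_
    exact Polynomial.coeff_ne_zero_of_eq_degree h h0
  have hlim := Polynomial.div_tendsto_atTop_zero_of_degree_lt P _ hdeg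
  set β := volume.real (closedBall (0 : EuclideanSpace ℝ (Fin n)) 1)
  have hβ : 0 < β := ENNReal.toReal_pos
    (measure_closedBall_pos _ _ one_pos).ne' (isCompact_closedBall _ _).measure_ne_top
  refine hβ.not_ge (ge_of_tendsto hlim ?_)
  filter_upwards [Filter.eventually_gt_atTop 0] with t ht
  obtain ⟨x, hx⟩ := hKne
  rw [Polynomial.eval_pow, Polynomial.eval_X, le_div_iff₀ (by positivity), hP t ht.le]
  have hsub : x +ᵥ t • closedBall (0 : EuclideanSpace ℝ (Fin n)) 1 ⊆
      K + t • closedBall (0 : EuclideanSpace ℝ (Fin n)) 1 := by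
    rintro _ ⟨y, hy, rfl⟩
    exact Set.add_mem_add hx hy
  refine le_trans (le_of_eq ?_) (measureReal_mono hsub
    (hK.add ((isCompact_closedBall _ _).smul t)).measure_ne_top)
  rw [measureReal_def volume (_ +ᵥ _), measure_vadd, Measure.addHaar_smul, ENNReal.toReal_mul,
    ENNReal.toReal_ofReal (abs_nonneg _), finrank_euclideanSpace_fin, abs_of_pos (by positivity),
    mul_comm]
  rfl

end

/-- **Stability of the Steiner polynomial in dimensions ≤ 5.** If `1 ≤ n ≤ 5`, `K ⊆ ℝⁿ`
is a convex body with nonempty interior, and `P` is the Steiner polynomial of `K`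
(`P(t) = vol(K + tB)` for `t ≥ 0`, `deg P ≤ n`), then every complex root of `P`
has strictly negative real part. -/
theorem steiner_polynomial_stable_of_dim_le_five (n : ℕ) (hn1 : 1 ≤ n) (hn5 : n ≤ 5)
    (K : Set (EuclideanSpace ℝ (Fin n)))
    (hKne : K.Nonempty) (hKcomp : IsCompact K) (hKconv : Convex ℝ K)
    (hKint : (interior K).Nonempty)
    (P : Polynomial ℝ) (hPdeg : P.natDegree ≤ n)
    (hP : ∀ t : ℝ, 0 ≤ t →
      P.eval t = (volume (K + t • closedBall (0 : EuclideanSpace ℝ (Fin n)) 1)).toReal) :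
    ∀ z : ℂ, Polynomial.aeval z P = 0 → z.re < 0 := by
  have hv : 0 < volume.real K := ENNReal.toReal_pos
    (Measure.measure_pos_of_nonempty_interior _ hKint).ne' hKcomp.measure_ne_top
  set W : ℕ → ℝ := fun k => P.coeff k / Nat.choose 5 k with hWdef
  have hcoeff : ∀ k ≤ 5, P.coeff k = Nat.choose 5 k * W k := fun k hk =>
    (mul_div_cancel₀ _ (Nat.cast_ne_zero.2 (Nat.choose_pos hk).ne')).symm
  have c0 : P.coeff 0 = W 0 := by simpa using hcoeff 0 (by norm_num)
  have c1 : P.coeff 1 = 5 * W 1 := by simpa using hcoeff 1 (by norm_num)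
  have c2 : P.coeff 2 = 10 * W 2 := by simpa [Nat.choose] using hcoeff 2 (by norm_num)
  have c3 : P.coeff 3 = 10 * W 3 := by simpa [Nat.choose] using hcoeff 3 (by norm_num)
  have c4 : P.coeff 4 = 5 * W 4 := by simpa [Nat.choose] using hcoeff 4 (by norm_num)
  have c5 : P.coeff 5 = W 5 := by simpa using hcoeff 5 (by norm_num)
  have hAF : IsAleksandrovFenchel W :=
    isAleksandrovFenchel_of_volume_eq hn1 hn5 hKcomp hKconv hv fun t ht => by
      rw [measureReal_def, ← hP t ht, Polynomial.eval_eq_sum_range' (n := 6) (by omega)]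
      simp only [Finset.sum_range_succ, Finset.sum_range_zero, c0, c1, c2, c3, c4, c5,
        normalizedQuintic]
      ring
  have hW0 : 0 < W 0 := by
    have := hP 0 le_rfl
    rw [Set.zero_smul_set (nonempty_closedBall.2 zero_le_one), add_zero,
      ← Polynomial.coeff_zero_eq_eval_zero, c0] at this
    rwa [this]
  have hWn : 0 < W n := lt_of_le_of_ne (hAF.nonneg n hn5) fun h =>
    coeff_ne_zero_of_eval_eq_volume hKne hKcomp hPdeg hP (by rw [hcoeff n hn5, ← h, mul_zero])
  intro z hz
  refine re_neg_of_ultraLogConcave hn1 hn5 (hAF.pos hn1 hn5 hW0 hWn) (fun k hk => ?_)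
    hAF.log_concave (z := z) ?_
  · simp [hWdef, Polynomial.coeff_eq_zero_of_natDegree_lt (hPdeg.trans_lt hk)]
  · rw [Polynomial.aeval_eq_sum_range' (n := 6) (by omega)] at hz
    simp only [Finset.sum_range_succ, Finset.sum_range_zero, c0, c1, c2, c3, c4, c5,
      Complex.real_smul] at hz
    push_cast at hz
    rw [← hz]
    ring
end

section
/- Fix n ≥ 1 and assume stability of the Steiner polynomial holds in dimension n: for every convex body L ⊆ ℝⁿ with nonempty interior and every real polynomial Q of degree at most n with Q(t) = vol(L + tB) for all t ≥ 0, every complex root of Q has strictly negative real part. Let K ⊆ ℝⁿ be a convex body with nonempty interior, let ρ > 0, and suppose ρB is a Minkowski summand of K (there exists a convex body M with M + ρB = K). If P is a real polynomial of degree at most n with P(t) = vol(K + tB) for all t ≥ 0, then every complex root z of P satisfies Re z ≤ −ρ. (Upper bound of the main theorem: the real parts of the roots of the Steiner polynomial are at most −ρ_min.) -/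
open MeasureTheory Metric Pointwise

theorem Polynomial.eval_eq_sum_eval_mul_basis {F ι : Type*} [Field F] [DecidableEq ι]
    (q : Polynomial F) {s : Finset ι} {v : ι → F} (hv : Set.InjOn v s)
    (hq : q.natDegree < s.card) (r : F) :
    q.eval r = ∑ i ∈ s, q.eval (v i) * (Lagrange.basis s v i).eval r := by
  conv_lhs => rw [Lagrange.eq_interpolate (f := q) hv
    (Polynomial.degree_le_natDegree.trans_lt (by exact_mod_cast hq))]
  simp [Lagrange.interpolate_apply, Polynomial.eval_finsetSum]

section NearestPoint

variable {E : Type*} [NormedAddCommGroup E] [InnerProductSpace ℝ E]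

/-- `p` is the nearest-point map onto `M`, described by the obtuse-angle criterion. -/
def IsNearestPointMap (M : Set E) (p : E → E) : Prop :=
  ∀ x, p x ∈ M ∧ ∀ w ∈ M, inner ℝ (x - p x) (w - p x) ≤ 0

/-- The dilation of the space away from a convex set along its nearest-point map. -/
def dilateFrom (p : E → E) (r : ℝ) (x : E) : E := p x + r • (x - p x)

theorem exists_isNearestPointMap {M : Set E} (hne : M.Nonempty) (hM : IsComplete M)
    (hconv : Convex ℝ M) : ∃ p, IsNearestPointMap M p := by
  choose p hpM hp using exists_norm_eq_iInf_of_complete_convex hne hM hconv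
  exact ⟨p, fun x => ⟨hpM x, (norm_eq_iInf_iff_real_inner_le_zero hconv (hpM x)).1 (hp x)⟩⟩

theorem dilateFrom_one (p : E → E) (x : E) : dilateFrom p 1 x = x := by
  rw [dilateFrom, one_smul, add_sub_cancel]

namespace IsNearestPointMap

variable {M : Set E} {p : E → E}

theorem inner_sub_nonneg (hp : IsNearestPointMap M p) (x y : E) :
    0 ≤ inner ℝ (p x - p y) ((x - y) - (p x - p y)) := by
  have h1 := (hp x).2 _ (hp y).1
  have h2 := (hp y).2 _ (hp x).1
  have e : inner ℝ (p x - p y) ((x - y) - (p x - p y))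
      = -inner ℝ (x - p x) (p y - p x) - inner ℝ (y - p y) (p x - p y) := by
    rw [← neg_sub (p x) (p y), inner_neg_right, neg_neg, ← inner_sub_left, real_inner_comm]
    congr 1
    abel
  linarith

theorem lipschitzWith (hp : IsNearestPointMap M p) : LipschitzWith 1 p := by
  refine LipschitzWith.of_dist_le_mul fun x y => ?_
  have h := hp.inner_sub_nonneg x y
  rw [inner_sub_right, real_inner_self_eq_norm_sq] at h
  have h' := real_inner_le_norm (p x - p y) (x - y)
  rw [dist_eq_norm, dist_eq_norm, NNReal.coe_one, one_mul]
  by_contra! hlt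
  nlinarith [norm_nonneg (x - y)]

theorem eq_of_forall_inner_le (hp : IsNearestPointMap M p) {x v : E} (hv : v ∈ M)
    (h : ∀ w ∈ M, inner ℝ (x - v) (w - v) ≤ 0) : p x = v := by
  have h1 := (hp x).2 v hv
  have h2 := h _ (hp x).1
  have e : inner ℝ (p x - v) (p x - v)
      = inner ℝ (x - p x) (v - p x) + inner ℝ (x - v) (p x - v) := by
    rw [← neg_sub (p x) v, inner_neg_right, ← sub_eq_neg_add, ← inner_sub_left]
    congr 1
    abel
  rw [real_inner_self_eq_norm_sq] at e
  rw [← sub_eq_zero, ← norm_eq_zero, ← sq_eq_zero_iff]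
  exact le_antisymm (by linarith) (sq_nonneg _)

theorem dilateFrom_eq (hp : IsNearestPointMap M p) {r : ℝ} (hr : 0 ≤ r) (x : E) :
    p (dilateFrom p r x) = p x := by
  refine hp.eq_of_forall_inner_le (hp x).1 fun w hw => ?_
  rw [dilateFrom, add_sub_cancel_left, real_inner_smul_left]
  exact mul_nonpos_of_nonneg_of_nonpos hr ((hp x).2 w hw)

theorem dilateFrom_dilateFrom (hp : IsNearestPointMap M p) {r s : ℝ} (hr : 0 ≤ r) (x : E) :
    dilateFrom p s (dilateFrom p r x) = dilateFrom p (s * r) x := by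
  rw [dilateFrom, hp.dilateFrom_eq hr, dilateFrom, dilateFrom, add_sub_cancel_left, mul_smul]

theorem dilateFrom_injective (hp : IsNearestPointMap M p) {r : ℝ} (hr : 0 < r) :
    Function.Injective (dilateFrom p r) := by
  refine Function.LeftInverse.injective (g := dilateFrom p r⁻¹) fun x => ?_
  rw [hp.dilateFrom_dilateFrom hr.le, inv_mul_cancel₀ hr.ne', dilateFrom_one]

theorem norm_sub_le (hp : IsNearestPointMap M p) {x v : E} (hv : v ∈ M) :
    ‖x - p x‖ ≤ ‖x - v‖ := by
  have h1 := (hp x).2 v hv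
  have e : ‖x - v‖ ^ 2 = ‖x - p x‖ ^ 2 - 2 * inner ℝ (x - p x) (v - p x) + ‖v - p x‖ ^ 2 := by
    rw [← norm_sub_sq_real]
    congr 2
    abel
  rw [← sq_le_sq₀ (norm_nonneg _) (norm_nonneg _)]
  nlinarith [sq_nonneg ‖v - p x‖]

theorem add_closedBall_eq (hp : IsNearestPointMap M p) {s : ℝ} (hs : 0 ≤ s) :
    M + s • closedBall (0 : E) 1 = {x | ‖x - p x‖ ≤ s} := by
  rw [smul_unitClosedBall_of_nonneg hs]
  ext x
  rw [Set.mem_add, Set.mem_ofPred_eq]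
  constructor
  · rintro ⟨v, hv, w, hw, rfl⟩
    refine (hp.norm_sub_le hv).trans ?_
    simpa using hw
  · intro h
    exact ⟨p x, (hp x).1, x - p x, by simpa using h, by abel⟩

theorem dilateFrom_image (hp : IsNearestPointMap M p) {r : ℝ} (hr : 0 < r) :
    dilateFrom p r '' (M + closedBall (0 : E) 1) = M + r • closedBall (0 : E) 1 := by
  have h1 := hp.add_closedBall_eq zero_le_one
  rw [one_smul] at h1
  rw [h1, hp.add_closedBall_eq hr.le]
  have key : ∀ (c : ℝ), 0 < c → ∀ x, ‖dilateFrom p c x - p (dilateFrom p c x)‖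
      = c * ‖x - p x‖ := fun c hc x => by
    rw [hp.dilateFrom_eq hc.le, dilateFrom, add_sub_cancel_left, norm_smul,
      Real.norm_of_nonneg hc.le]
  ext y
  constructor
  · rintro ⟨x, hx, rfl⟩
    rw [Set.mem_ofPred_eq] at hx ⊢
    rw [key r hr]
    nlinarith
  · intro hy
    rw [Set.mem_ofPred_eq] at hy
    refine ⟨dilateFrom p r⁻¹ y, ?_, ?_⟩
    · rw [Set.mem_ofPred_eq, key _ (inv_pos.2 hr), inv_mul_le_iff₀ hr, mul_one]
      exact hy
    · rw [hp.dilateFrom_dilateFrom (inv_pos.2 hr).le, mul_inv_cancel₀ hr.ne', dilateFrom_one]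

theorem inner_fderiv_nonneg (hp : IsNearestPointMap M p) {A : E →L[ℝ] E} {x : E}
    (hA : HasFDerivAt p A x) (v : E) :
    0 ≤ inner ℝ (A v) (v - A v) := by
  have hline : HasDerivAt (fun t : ℝ => p (x + t • v)) (A v) 0 :=
    hA.hasLineDerivAt v
  have ht := hline.tendsto_slope_zero
  simp only [zero_add, zero_smul, add_zero] at ht
  refine ge_of_tendsto (ht.inner (tendsto_const_nhds.sub ht)) ?_
  filter_upwards [self_mem_nhdsWithin] with t ht0
  have ht0 : t ≠ 0 := ht0
  have h := hp.inner_sub_nonneg (x + t • v) x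
  have e : v - t⁻¹ • (p (x + t • v) - p x)
      = t⁻¹ • ((x + t • v - x) - (p (x + t • v) - p x)) := by
    rw [add_sub_cancel_left, smul_sub _ (t • v), smul_smul, inv_mul_cancel₀ ht0, one_smul]
  rw [e, real_inner_smul_left, real_inner_smul_right, ← mul_assoc]
  exact mul_nonneg (mul_self_nonneg _) h

end IsNearestPointMap

section Det

variable [FiniteDimensional ℝ E]

theorem det_add_smul_pos {A : E →L[ℝ] E} (hA : ∀ v, 0 ≤ inner ℝ (A v) (v - A v))
    {r : ℝ} (hr : 0 < r) : 0 < (A + r • (ContinuousLinearMap.id ℝ E - A)).det := by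
  set f : ℝ → ℝ := fun r => (A + r • (ContinuousLinearMap.id ℝ E - A)).det with hf
  have hcont : Continuous f := ContinuousLinearMap.continuous_det.comp (by fun_prop)
  have hne : ∀ r ∈ Set.Ioi (0 : ℝ), f r ≠ 0 := by
    intro r hr h0
    obtain ⟨v, hv, hv0⟩ := Submodule.exists_mem_ne_zero_of_ne_bot
      (LinearMap.bot_lt_ker_of_det_eq_zero h0).ne'
    have hv : A v + r • (v - A v) = 0 := by simpa using hv
    have h1 : inner ℝ (A v + r • (v - A v)) (v - A v) = 0 := by rw [hv, inner_zero_left]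
    rw [inner_add_left, real_inner_smul_left, real_inner_self_eq_norm_sq] at h1
    have hr : 0 < r := hr
    have h2 : ‖v - A v‖ = 0 := by
      have := hA v
      have h3 : r * ‖v - A v‖ ^ 2 = 0 := le_antisymm (by linarith) (by positivity)
      simpa [hr.ne'] using h3
    rw [norm_eq_zero] at h2
    rw [h2, smul_zero, add_zero] at hv
    rw [hv, sub_zero] at h2
    exact hv0 h2
  have h1 : f 1 = 1 := by
    simp only [hf, one_smul, add_sub_cancel]
    exact LinearMap.det_id
  by_contra! hle
  obtain ⟨c, hc, hc0⟩ := isPreconnected_Ioi.intermediate_value (Set.mem_Ioi.2 hr)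
    (Set.mem_Ioi.2 one_pos) hcont.continuousOn ⟨hle, h1.ge.trans' zero_le_one⟩
  exact hne c hc hc0

theorem exists_polynomial_eval_eq_det (A B : E →L[ℝ] E) :
    ∃ q : Polynomial ℝ, q.natDegree ≤ Module.finrank ℝ E ∧
      ∀ r, q.eval r = (A + r • B).det := by
  set b := Module.finBasis ℝ E
  set A' := LinearMap.toMatrix b b (A : E →ₗ[ℝ] E)
  set B' := LinearMap.toMatrix b b (B : E →ₗ[ℝ] E)
  refine ⟨((Polynomial.X : Polynomial ℝ) • B'.map Polynomial.C + A'.map Polynomial.C).det,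
    (Polynomial.natDegree_det_X_add_C_le B' A').trans_eq (by simp), fun r => ?_⟩
  rw [ContinuousLinearMap.det, ← LinearMap.det_toMatrix b, ← Polynomial.coe_evalRingHom,
    RingHom.map_det]
  congr 1
  ext i j
  simp [A', B', add_comm, mul_comm r]

end Det

end NearestPoint

section Volume

variable {E : Type*} [NormedAddCommGroup E] [InnerProductSpace ℝ E] [FiniteDimensional ℝ E]
  [MeasurableSpace E] [BorelSpace E] (μ : Measure E) [μ.IsAddHaarMeasure]

theorem LipschitzWith.addHaar_image_eq_zero {C : NNReal} {f : E → E} (hf : LipschitzWith C f)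
    {s : Set E} (hs : μ s = 0) : μ (f '' s) = 0 := by
  have h1 : Measure.hausdorffMeasure (Module.finrank ℝ E) ≪ μ :=
    Measure.absolutelyContinuous_isAddHaarMeasure _ _
  have h2 : μ ≪ Measure.hausdorffMeasure (Module.finrank ℝ E) :=
    Measure.absolutelyContinuous_isAddHaarMeasure _ _
  refine h2 (le_antisymm ((hf.hausdorffMeasure_image_le (Nat.cast_nonneg _) s).trans ?_) zero_le)
  rw [h1 hs, mul_zero]

theorem IsNearestPointMap.integrableOn_det_and_integral_eq {M : Set E} {p : E → E}
    (hp : IsNearestPointMap M p) (hM : IsCompact M) {r : ℝ} (hr : 0 < r) :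
    IntegrableOn (fun x => (fderiv ℝ p x + r • (ContinuousLinearMap.id ℝ E - fderiv ℝ p x)).det)
        ((M + closedBall (0 : E) 1) ∩ {x | DifferentiableAt ℝ p x}) μ ∧
      ∫ x in (M + closedBall (0 : E) 1) ∩ {x | DifferentiableAt ℝ p x},
        (fderiv ℝ p x + r • (ContinuousLinearMap.id ℝ E - fderiv ℝ p x)).det ∂μ
        = (μ (M + r • closedBall (0 : E) 1)).toReal := by
  set D := {x | DifferentiableAt ℝ p x}
  set S := (M + closedBall (0 : E) 1) ∩ D
  set J : E → ℝ :=
    fun x => (fderiv ℝ p x + r • (ContinuousLinearMap.id ℝ E - fderiv ℝ p x)).det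
  have hcomp : ∀ c : ℝ, IsCompact (M + c • closedBall (0 : E) 1) := fun c =>
    hM.add ((isCompact_closedBall 0 1).smul c)
  have hDm : MeasurableSet D := measurableSet_of_differentiableAt ℝ p
  have hSm : MeasurableSet S :=
    (hM.add (isCompact_closedBall 0 1)).measurableSet.inter hDm
  have hderiv : ∀ x ∈ S, HasFDerivWithinAt (dilateFrom p r)
      (fderiv ℝ p x + r • (ContinuousLinearMap.id ℝ E - fderiv ℝ p x)) S x := by
    intro x hx
    have h : HasFDerivAt p (fderiv ℝ p x) x := DifferentiableAt.hasFDerivAt hx.2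
    exact (h.add (((hasFDerivAt_id x).sub h).const_smul r)).hasFDerivWithinAt
  have hinj : Set.InjOn (dilateFrom p r) S := (hp.dilateFrom_injective hr).injOn
  have hJ : ∀ x ∈ S, |J x| = J x := fun x hx =>
    abs_of_pos (det_add_smul_pos (hp.inner_fderiv_nonneg (DifferentiableAt.hasFDerivAt hx.2)) hr)
  have hlip : ∃ C, LipschitzWith C (dilateFrom p r) :=
    ⟨_, hp.lipschitzWith.add ((lipschitzWith_smul r).comp
      (LipschitzWith.id.sub hp.lipschitzWith))⟩
  obtain ⟨C, hC⟩ := hlip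
  have hDc : μ Dᶜ = 0 := hp.lipschitzWith.ae_differentiableAt
  have himage : μ (dilateFrom p r '' S) = μ (M + r • closedBall (0 : E) 1) := by
    refine le_antisymm (measure_mono ?_) ?_
    · rw [← hp.dilateFrom_image hr]
      exact Set.image_mono Set.inter_subset_left
    · calc μ (M + r • closedBall (0 : E) 1)
          ≤ μ (dilateFrom p r '' S ∪ dilateFrom p r '' Dᶜ) := by
            refine measure_mono ?_
            rw [← hp.dilateFrom_image hr, ← Set.image_union]
            refine Set.image_mono fun x hx => ?_
            by_cases hxD : x ∈ D
            · exact Or.inl ⟨hx, hxD⟩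
            · exact Or.inr hxD
        _ ≤ μ (dilateFrom p r '' S) + μ (dilateFrom p r '' Dᶜ) := measure_union_le _ _
        _ = μ (dilateFrom p r '' S) := by rw [hC.addHaar_image_eq_zero μ hDc, add_zero]
  constructor
  · have h := (integrableOn_image_iff_integrableOn_abs_det_fderiv_smul μ hSm hderiv hinj
      (fun _ => (1 : ℝ))).1 (integrableOn_const (by
        rw [himage]; exact (hcomp r).measure_lt_top.ne))
    refine h.congr_fun (fun x hx => ?_) hSm
    exact (mul_one _).trans (hJ x hx)
  · have h := integral_image_eq_integral_abs_det_fderiv_smul μ hSm hderiv hinj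
      (fun _ => (1 : ℝ))
    rw [setIntegral_const, smul_eq_mul, mul_one, Measure.real, himage] at h
    rw [h]
    refine setIntegral_congr_fun hSm fun x hx => ?_
    rw [smul_eq_mul, mul_one]
    exact (hJ x hx).symm

/-- **Steiner formula**: the volume of the outer parallel bodies of a compact convex set is
polynomial in the radius, being recovered by Lagrange interpolation at any
`finrank ℝ E + 1` positive nodes. -/
theorem addHaar_parallel_body_eq_sum_basis {M : Set E} (hne : M.Nonempty) (hM : IsCompact M)
    (hconv : Convex ℝ M) {s : Finset ℕ} {v : ℕ → ℝ} (hv : Set.InjOn v s)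
    (hs : Module.finrank ℝ E < s.card) (hpos : ∀ i ∈ s, 0 < v i) {r : ℝ} (hr : 0 < r) :
    (μ (M + r • closedBall (0 : E) 1)).toReal =
      ∑ i ∈ s, (μ (M + v i • closedBall (0 : E) 1)).toReal * (Lagrange.basis s v i).eval r := by
  obtain ⟨p, hp⟩ := exists_isNearestPointMap hne hM.isComplete hconv
  rw [← (hp.integrableOn_det_and_integral_eq μ hM hr).2]
  rw [Finset.sum_congr rfl fun i hi => by
    rw [← (hp.integrableOn_det_and_integral_eq μ hM (hpos i hi)).2, ← integral_mul_const]]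
  rw [← integral_finsetSum _ fun i hi =>
    (hp.integrableOn_det_and_integral_eq μ hM (hpos i hi)).1.mul_const _]
  congr 1
  ext x
  obtain ⟨q, hq, hqe⟩ :=
    exists_polynomial_eval_eq_det (fderiv ℝ p x) (ContinuousLinearMap.id ℝ E - fderiv ℝ p x)
  simp only [← hqe]
  exact q.eval_eq_sum_eval_mul_basis hv (hq.trans_lt hs) r

theorem addHaar_parallel_body_eq_eval {M : Set E} (hne : M.Nonempty) (hM : IsCompact M)
    (hconv : Convex ℝ M) {q : Polynomial ℝ} (hq : q.natDegree ≤ Module.finrank ℝ E) {a : ℝ}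
    (h : ∀ r, a ≤ r → q.eval r = (μ (M + r • closedBall (0 : E) 1)).toReal) {r : ℝ}
    (hr : 0 < r) : q.eval r = (μ (M + r • closedBall (0 : E) 1)).toReal := by
  set s := Finset.range (Module.finrank ℝ E + 1)
  set v : ℕ → ℝ := fun i => |a| + 1 + i
  have hv : Set.InjOn v s := fun i _ j _ hij => by simpa [v] using hij
  have hs : Module.finrank ℝ E < s.card := by simp [s]
  have hva : ∀ i, a ≤ v i := fun i => by
    have := le_abs_self a
    have : (0 : ℝ) ≤ i := Nat.cast_nonneg i
    simp only [v]
    linarith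
  rw [addHaar_parallel_body_eq_sum_basis μ hne hM hconv hv hs
    (fun i _ => by positivity) hr, q.eval_eq_sum_eval_mul_basis hv (hq.trans_lt hs) r]
  exact Finset.sum_congr rfl fun i _ => by rw [h _ (hva i)]

end Volume

/-- **Upper bound on the roots of the Steiner polynomial.** Assume the Steiner polynomial
of every convex body with nonempty interior in `ℝⁿ` is stable. If `ρB` is a Minkowski
summand of the convex body `K` (in particular whenever `ρ ≤ ρ_min`, the minimum principal
radius of curvature of a `C²` body `K`), then every complex root `z` of the Steiner
polynomial of `K` satisfies `Re z ≤ -ρ`. -/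
theorem steiner_roots_le_neg_rho (n : ℕ) (hn : 1 ≤ n)
    (hstab : ∀ L : Set (EuclideanSpace ℝ (Fin n)), L.Nonempty → IsCompact L → Convex ℝ L →
      (interior L).Nonempty → ∀ Q : Polynomial ℝ, Q.natDegree ≤ n →
      (∀ t : ℝ, 0 ≤ t →
        Q.eval t = (volume (L + t • closedBall (0 : EuclideanSpace ℝ (Fin n)) 1)).toReal) →
      ∀ z : ℂ, Polynomial.aeval z Q = 0 → z.re < 0)
    (K : Set (EuclideanSpace ℝ (Fin n)))
    (hKne : K.Nonempty) (hKcomp : IsCompact K) (hKconv : Convex ℝ K)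
    (hKint : (interior K).Nonempty)
    (ρ : ℝ) (hρ : 0 < ρ)
    (hsummand : ∃ M : Set (EuclideanSpace ℝ (Fin n)), M.Nonempty ∧ IsCompact M ∧
      Convex ℝ M ∧ M + ρ • closedBall (0 : EuclideanSpace ℝ (Fin n)) 1 = K)
    (P : Polynomial ℝ) (hPdeg : P.natDegree ≤ n)
    (hP : ∀ t : ℝ, 0 ≤ t →
      P.eval t = (volume (K + t • closedBall (0 : EuclideanSpace ℝ (Fin n)) 1)).toReal) :
    ∀ z : ℂ, Polynomial.aeval z P = 0 → z.re ≤ -ρ := by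
  obtain ⟨M, hMne, hMcomp, hMconv, rfl⟩ := hsummand
  intro z hz
  have hball : Convex ℝ (closedBall (0 : EuclideanSpace ℝ (Fin n)) 1) := convex_closedBall 0 1
  have hadd : ∀ a b : ℝ, 0 ≤ a → 0 ≤ b →
      M + a • closedBall (0 : EuclideanSpace ℝ (Fin n)) 1
        + b • closedBall (0 : EuclideanSpace ℝ (Fin n)) 1
        = M + (a + b) • closedBall (0 : EuclideanSpace ℝ (Fin n)) 1 := fun a b ha hb => by
    rw [add_assoc, hball.add_smul ha hb]
  have hvol : ∀ r : ℝ, 0 < r → P.eval (r - ρ)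
      = (volume (M + r • closedBall (0 : EuclideanSpace ℝ (Fin n)) 1)).toReal := by
    intro r hr
    have h := addHaar_parallel_body_eq_eval volume hMne hMcomp hMconv
      (q := P.comp (Polynomial.X - Polynomial.C ρ)) (a := ρ)
      (by simpa [Polynomial.natDegree_comp] using hPdeg)
      (fun r hr => by
        rw [Polynomial.eval_comp, Polynomial.eval_sub, Polynomial.eval_X, Polynomial.eval_C,
          hP _ (sub_nonneg.2 hr), hadd _ _ hρ.le (sub_nonneg.2 hr), add_sub_cancel]) hr
    simpa using h
  refine le_of_forall_pos_le_add fun ε hε => ?_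
  have hint : (interior (M + ε • closedBall (0 : EuclideanSpace ℝ (Fin n)) 1)).Nonempty := by
    obtain ⟨m, hm⟩ := hMne
    refine ⟨m + 0, subset_interior_add_right (Set.add_mem_add hm ?_)⟩
    rw [smul_unitClosedBall_of_nonneg hε.le, interior_closedBall _ hε.ne']
    exact mem_ball_self hε
  have hlt := hstab (M + ε • closedBall 0 1)
    (hMne.add ((nonempty_closedBall.2 zero_le_one).smul_set))
    (hMcomp.add ((isCompact_closedBall 0 1).smul ε)) (hMconv.add (hball.smul ε)) hint
    (P.comp (Polynomial.X + Polynomial.C (ε - ρ)))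
    (by rwa [Polynomial.natDegree_comp, Polynomial.natDegree_X_add_C, mul_one])
    (fun t ht => by
      rw [hadd _ _ hε.le ht, ← hvol _ (by linarith), Polynomial.eval_comp, Polynomial.eval_add,
        Polynomial.eval_X, Polynomial.eval_C]
      congr 1
      ring)
    (z - ((ε - ρ : ℝ) : ℂ))
    (by
      rw [Polynomial.aeval_comp, map_add, Polynomial.aeval_X, Polynomial.aeval_C,
        Complex.coe_algebraMap, sub_add_cancel, hz])
  rw [Complex.sub_re, Complex.ofReal_re] at hlt
  linarith
end
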